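/- Let T = (T_1, …, T_d) be a projectively hyponormal commuting d-tuple of bounded operators on a complex separable Hilbert space H, and suppose that each single operator T_i is m_i-polynomially cyclic. Then each commutator [T_j*, T_i] is trace class, and ‖[T_i*, T_i]‖₁ ≤ (m_i/π) ν(σ(T_i)), while for i ≠ j, ‖[T_j*, T_i]‖₁ ≤ (m_i/π) ν(σ(T_i)) + (m_j/π) ν(σ(T_j)), where σ(T_i) is the spectrum of T_i and ν is planar Lebesgue measure on ℂ. -/

import Mathlib

open ContinuousLinearMap MeasureTheory
open scoped ENNReal NNReal ComplexOrder

noncomputable section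

variable {H H₁ H₂ K : Type*}
variable [NormedAddCommGroup H] [InnerProductSpace ℂ H] [CompleteSpace H]
variable [NormedAddCommGroup H₁] [InnerProductSpace ℂ H₁] [CompleteSpace H₁]
variable [NormedAddCommGroup H₂] [InnerProductSpace ℂ H₂] [CompleteSpace H₂]
variable [NormedAddCommGroup K] [InnerProductSpace ℂ K] [CompleteSpace K]

/-- The commutator `[A, B] = A * B - B * A` of two bounded operators. -/
def cmt (A B : H →L[ℂ] H) : H →L[ℂ] H := A * B - B * A

/-- A bounded operator `T` is hyponormal if `[T*, T] ≥ 0`. -/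
def Hyponormal (T : H →L[ℂ] H) : Prop := (cmt (adjoint T) T).IsPositive

/-- A `d`-tuple is projectively hyponormal if every linear combination is hyponormal. -/
def ProjHyponormal {d : ℕ} (T : Fin d → H →L[ℂ] H) : Prop :=
  ∀ α : Fin d → ℂ, Hyponormal (∑ i, α i • T i)

/-- A `d`-tuple is jointly hyponormal if the block operator `(([T j*, T i]))` is
non-negative definite on the `d`-fold direct sum. -/
def JointlyHyponormal {d : ℕ} (T : Fin d → H →L[ℂ] H) : Prop :=
  ∀ x : Fin d → H, 0 ≤ ∑ i, ∑ j, @inner ℂ _ _ (x i) (cmt (adjoint (T j)) (T i) (x j))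

/-- The trace norm `‖T‖₁ = sup Σ |⟨T fᵢ, gᵢ⟩|`, the supremum being taken over all pairs of
(finite) orthonormal families. -/
def traceNorm (T : H →L[ℂ] H) : ℝ≥0∞ :=
  ⨆ (n : ℕ) (f : Fin n → H) (g : Fin n → H) (_ : Orthonormal ℂ f) (_ : Orthonormal ℂ g),
    ∑ i, (‖@inner ℂ _ _ (T (f i)) (g i)‖₊ : ℝ≥0∞)

/-- A bounded operator is trace class if its trace norm is finite. -/
def IsTraceClass (T : H →L[ℂ] H) : Prop := traceNorm T ≠ ⊤

/-- The Hilbert-Schmidt norm `‖T‖₂ = (Σ ‖T eₙ‖²)^(1/2)`. -/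
def hsNorm (T : H →L[ℂ] H) : ℝ≥0∞ :=
  (⨆ (n : ℕ) (f : Fin n → H) (_ : Orthonormal ℂ f), ∑ i, (‖T (f i)‖₊ : ℝ≥0∞) ^ 2) ^ (1/2 : ℝ)

/-- The word `T₁^(n 1) ⋯ T d^(n d)` in a `d`-tuple of operators. -/
def opWord {d : ℕ} (T : Fin d → H →L[ℂ] H) (n : Fin d → ℕ) : H →L[ℂ] H :=
  (List.ofFn fun j => (T j) ^ (n j)).prod

/-- A single operator is `m`-polynomially cyclic if `m` is the least cardinality of a finite
set `ξ` such that the span of `{T^n v : v ∈ ξ, n ≥ 0}` is dense. -/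
def IsPolyCyclicOp (T : H →L[ℂ] H) (m : ℕ) : Prop :=
  IsLeast {k : ℕ | ∃ ξ : Finset H, ξ.card = k ∧
    Dense ((Submodule.span ℂ {x | ∃ v ∈ ξ, ∃ n : ℕ, x = (T ^ n) v} : Submodule ℂ H) : Set H)} m

/-- A commuting `d`-tuple is `m`-polynomially cyclic if `m` is the least cardinality of a finite
set `ξ` such that the span of `{T₁^{i₁} ⋯ T_d^{i_d} v : v ∈ ξ}` is dense. -/
def IsPolyCyclicTuple {d : ℕ} (T : Fin d → H →L[ℂ] H) (m : ℕ) : Prop :=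
  IsLeast {k : ℕ | ∃ ξ : Finset H, ξ.card = k ∧
    Dense ((Submodule.span ℂ {x | ∃ v ∈ ξ, ∃ n : Fin d → ℕ, x = opWord T n v} :
      Submodule ℂ H) : Set H)} m

/-- The determinant operator `dEt [[T*, T]]` of the block operator of commutators
`B i j = [T j*, T i]`, given by the symmetrized Laplace expansion. -/
def detOp {d : ℕ} (T : Fin d → H →L[ℂ] H) : H →L[ℂ] H :=
  ∑ σ : Equiv.Perm (Fin d), ∑ τ : Equiv.Perm (Fin d),
    ((Equiv.Perm.sign σ : ℤ) •
      (List.ofFn fun k => cmt (adjoint (T (σ (τ k)))) (T (τ k))).prod)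

/-- The standard polynomial `S n (A 1, …, A n) = Σ_σ sgn σ • A σ(1) ⋯ A σ(n)`. -/
def stdPoly {n : ℕ} (A : Fin n → H →L[ℂ] H) : H →L[ℂ] H :=
  ∑ σ : Equiv.Perm (Fin n), ((Equiv.Perm.sign σ : ℤ) • (List.ofFn fun k => A (σ k)).prod)

/-- The generalized commutator `GC(T*, T) = S_{2d}(T₁*, T₁, …, T_d*, T_d)` of Helton-Howe. -/
def genComm {d : ℕ} (T : Fin d → H →L[ℂ] H) : H →L[ℂ] H :=
  stdPoly (fun j : Fin (2 * d) =>
    if (j : ℕ) % 2 = 0 then adjoint (T ⟨(j : ℕ) / 2, by have := j.isLt; omega⟩)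
    else T ⟨(j : ℕ) / 2, by have := j.isLt; omega⟩)

/-- `P` is the orthogonal projection onto the subspace `K'`. -/
def IsOrthProjOn (P : H →L[ℂ] H) (K' : Submodule ℂ H) : Prop :=
  IsSelfAdjoint P ∧ (∀ x, P x ∈ K') ∧ (∀ x ∈ K', P x = x)

/-- The subspace `H_N` spanned by words of total degree at most `N` applied to `ξ`. -/
def HN {d : ℕ} (T : Fin d → H →L[ℂ] H) (ξ : Finset H) (N : ℕ) : Submodule ℂ H :=
  Submodule.span ℂ {x | ∃ v ∈ ξ, ∃ n : Fin d → ℕ, (∑ j, n j) ≤ N ∧ x = opWord T n v}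

/-- The word `T*_{η 1} T_{τ 1} T*_{η 2} T_{τ 2} ⋯ T_{τ (d-1)} T*_{η d}`. -/
def wordB {d : ℕ} (T : Fin d → H →L[ℂ] H) (η τ : Equiv.Perm (Fin d)) : H →L[ℂ] H :=
  (List.ofFn fun k : Fin d =>
    if (k : ℕ) + 1 = d then adjoint (T (η k)) else adjoint (T (η k)) * T (τ k)).prod

/-- The operator `P_N (Σ_η sgn η T*_{η 1} T_{τ 1} ⋯ T*_{η d}) P_N^⊥ T_{τ d} P_N`. -/
def bsExpr {d : ℕ} (hd : 0 < d) (T : Fin d → H →L[ℂ] H) (P : ℕ → H →L[ℂ] H)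
    (τ : Equiv.Perm (Fin d)) (N : ℕ) : H →L[ℂ] H :=
  P N * (∑ η : Equiv.Perm (Fin d), (Equiv.Perm.sign η : ℤ) • wordB T η τ) *
    ((1 - P N) * T (τ ⟨d - 1, by omega⟩) * P N)

/-- The class `BS_{m, θ}`. -/
def InBS {d : ℕ} (hd : 0 < d) (T : Fin d → H →L[ℂ] H) (m θ : ℕ) : Prop :=
  IsPolyCyclicTuple T m ∧ (detOp T).IsPositive ∧
  ∃ ξ : Finset H, ξ.card = m ∧
    Dense ((Submodule.span ℂ {x | ∃ v ∈ ξ, ∃ n : Fin d → ℕ, x = opWord T n v} :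
      Submodule ℂ H) : Set H) ∧
    ∃ P : ℕ → H →L[ℂ] H, (∀ N, IsOrthProjOn (P N) (HN T ξ N)) ∧
      (∀ (N : ℕ) (j : Fin d), P N * T j * (1 - P N) = 0) ∧
      (∀ (τ : Equiv.Perm (Fin d)) (N : ℕ),
        ‖bsExpr hd T P τ N‖ ≤
          (θ : ℝ) * (((N + d - 1).choose (d - 1) : ℝ))⁻¹ * ∏ i, ‖T i‖ ^ 2)

/-- Evaluation of a polynomial in `d` commuting variables on a commuting `d`-tuple. -/
def evalPoly {d : ℕ} (T : Fin d → H →L[ℂ] H) (p : MvPolynomial (Fin d) ℂ) : H →L[ℂ] H :=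
  ∑ mo ∈ p.support, MvPolynomial.coeff mo p • opWord T (fun i => mo i)

/-- A pure hyponormal operator: no nonzero closed subspace, reducing for `T`, on which `T`
restricts to a normal operator. -/
def IsPureHyponormal (T : H →L[ℂ] H) : Prop :=
  Hyponormal T ∧ ∀ K' : Submodule ℂ H, IsClosed (K' : Set H) →
    (∀ x ∈ K', T x ∈ K') → (∀ x ∈ K', adjoint T x ∈ K') →
    (∀ x ∈ K', ‖T x‖ = ‖adjoint T x‖) → K' = ⊥

/-- `tmul` realises `H` as the Hilbert space tensor product of `H₁` and `H₂`. -/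
structure IsHilbertTensor (tmul : H₁ →ₗ[ℂ] H₂ →ₗ[ℂ] H) : Prop where
  inner_tmul : ∀ x₁ x₂ y₁ y₂,
    @inner ℂ _ _ (tmul x₁ x₂) (tmul y₁ y₂) = @inner ℂ _ _ x₁ y₁ * @inner ℂ _ _ x₂ y₂
  dense_span :
    Dense ((Submodule.span ℂ {z | ∃ x y, z = tmul x y} : Submodule ℂ H) : Set H)

/-- `C` is the tensor product operator `A ⊗ B` relative to `tmul`. -/
def IsTensorOp (tmul : H₁ →ₗ[ℂ] H₂ →ₗ[ℂ] H) (A : H₁ →L[ℂ] H₁) (B : H₂ →L[ℂ] H₂)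
    (C : H →L[ℂ] H) : Prop :=
  ∀ x y, C (tmul x y) = tmul (A x) (B y)
section BergerShaw

universe u

lemma onb_sum_mem {X : Type u} [NormedAddCommGroup X] [InnerProductSpace ℂ X]
    {ι : Type*} [Fintype ι] {M : Submodule ℂ X} (b : OrthonormalBasis ι ℂ M) {y : X} (hy : y ∈ M) :
    ∑ i, ‖inner ℂ (b i : X) y‖ ^ 2 = ‖y‖ ^ 2 := by
  have := b.sum_sq_norm_inner_right ⟨y, hy⟩
  simpa using this

lemma onb_sum_le {X : Type u} [NormedAddCommGroup X] [InnerProductSpace ℂ X]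
    {ι : Type*} [Fintype ι] {M : Submodule ℂ X} (b : OrthonormalBasis ι ℂ M) (y : X) :
    ∑ i, ‖inner ℂ (b i : X) y‖ ^ 2 ≤ ‖y‖ ^ 2 := by
  have h : Orthonormal ℂ (fun i => (b i : X)) :=
    b.orthonormal.comp_linearIsometry M.subtypeₗᵢ
  exact h.sum_inner_products_le y

lemma onb_sum_proj {X : Type u} [NormedAddCommGroup X] [InnerProductSpace ℂ X]
    {ι : Type*} [Fintype ι] {M : Submodule ℂ X} [M.HasOrthogonalProjection]
    (b : OrthonormalBasis ι ℂ M) (y : X) :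
    ∑ i, ‖inner ℂ (b i : X) y‖ ^ 2 = ‖M.starProjection y‖ ^ 2 := by
  rw [← onb_sum_mem b (M.starProjection_apply_mem y)]
  refine Finset.sum_congr rfl fun i _ => ?_
  congr 2
  have : inner ℂ (b i : X) (y - M.starProjection y) = 0 :=
    M.sub_starProjection_mem_orthogonal y _ (b i).2
  rw [inner_sub_right] at this
  exact sub_eq_zero.mp this

/-- The key trace estimate on a finite dimensional subspace. -/
lemma trace_fd_le {X : Type u} [NormedAddCommGroup X] [InnerProductSpace ℂ X] [CompleteSpace X]
    (T : X →L[ℂ] X) {m : ℕ} {M M' : Submodule ℂ X} [FiniteDimensional ℂ M] [FiniteDimensional ℂ M']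
    (hMM' : M ≤ M') (hT : ∀ y ∈ M, T y ∈ M')
    (hfr : Module.finrank ℂ M' ≤ Module.finrank ℂ M + m)
    {ι : Type*} [Fintype ι] (e : OrthonormalBasis ι ℂ M) :
    ∑ a, (‖T (e a)‖ ^ 2 - ‖adjoint T (e a)‖ ^ 2) ≤ m * ‖T‖ ^ 2 := by
  have hN := Submodule.finrank_add_inf_finrank_orthogonal hMM'
  have hNm : Module.finrank ℂ ↥(Mᗮ ⊓ M') ≤ m := by omega
  have : FiniteDimensional ℂ ↥(Mᗮ ⊓ M') := Submodule.finiteDimensional_of_le inf_le_right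
  set g := stdOrthonormalBasis ℂ ↥(Mᗮ ⊓ M') with hg
  have h1 : ∀ a, ‖T (e a)‖ ^ 2 ≤ ∑ a', ‖inner ℂ (e a' : X) (T (e a))‖ ^ 2
      + ∑ b, ‖inner ℂ (g b : X) (T (e a))‖ ^ 2 := by
    intro a
    set z := T (e a) with hz
    have hz' : z ∈ M' := hT _ (e a).2
    have hmem : z - M.starProjection z ∈ Mᗮ ⊓ M' :=
      ⟨M.sub_starProjection_mem_orthogonal z,
        M'.sub_mem hz' (hMM' (M.starProjection_apply_mem z))⟩
    have hsq : ‖z‖ ^ 2 = ‖M.starProjection z‖ ^ 2 + ‖z - M.starProjection z‖ ^ 2 := by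
      have h := norm_add_sq_eq_norm_sq_add_norm_sq_of_inner_eq_zero
        (𝕜 := ℂ) (M.starProjection z) (z - M.starProjection z)
        (M.sub_starProjection_mem_orthogonal z _ (M.starProjection_apply_mem z))
      rw [add_sub_cancel] at h
      simpa [sq] using h
    rw [hsq, onb_sum_proj e z, ← onb_sum_mem g hmem]
    apply le_of_eq
    congr 1
    refine Finset.sum_congr rfl fun b _ => ?_
    congr 2
    rw [inner_sub_right]
    have : inner ℂ (g b : X) (M.starProjection z) = 0 :=
      Submodule.inner_left_of_mem_orthogonal (M.starProjection_apply_mem z) (g b).2.1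
    rw [this, sub_zero]
  have h2 : ∀ a, ∑ a', ‖inner ℂ (T (e a')) (e a : X)‖ ^ 2 ≤ ‖adjoint T (e a)‖ ^ 2 := by
    intro a
    refine le_trans (le_of_eq ?_) (onb_sum_le e (adjoint T (e a)))
    simp only [adjoint_inner_right]
  have h3 : ∑ a, ∑ b, ‖inner ℂ (g b : X) (T (e a))‖ ^ 2 ≤ m * ‖T‖ ^ 2 := by
    rw [Finset.sum_comm]
    have : ∀ b, ∑ a, ‖inner ℂ (g b : X) (T (e a))‖ ^ 2 ≤ ‖T‖ ^ 2 := by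
      intro b
      have h := onb_sum_le e (adjoint T (g b))
      have h' : ∑ a, ‖inner ℂ (g b : X) (T (e a))‖ ^ 2
          = ∑ a, ‖inner ℂ (e a : X) (adjoint T (g b))‖ ^ 2 := by
        refine Finset.sum_congr rfl fun a _ => ?_
        rw [adjoint_inner_right, norm_inner_symm]
      rw [h']
      refine h.trans ?_
      have hgb : ‖(g b : X)‖ = 1 := g.orthonormal.1 b
      have := (adjoint T).le_opNorm (g b : X)
      rw [hgb, mul_one, LinearIsometryEquiv.norm_map] at this
      gcongr
    calc _ ≤ ∑ b : Fin (Module.finrank ℂ ↥(Mᗮ ⊓ M')), ‖T‖ ^ 2 := Finset.sum_le_sum fun b _ => this b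
      _ ≤ _ := by
        simp only [Finset.sum_const, Finset.card_univ, Fintype.card_fin, nsmul_eq_mul]
        gcongr
  have h4 : ∑ a, ‖T (e a)‖ ^ 2 ≤ ∑ a, ∑ a', ‖inner ℂ (e a' : X) (T (e a))‖ ^ 2
      + ∑ a, ∑ b, ‖inner ℂ (g b : X) (T (e a))‖ ^ 2 := by
    rw [← Finset.sum_add_distrib]
    exact Finset.sum_le_sum fun a _ => h1 a
  have h5 : ∑ a, ∑ a', ‖inner ℂ (e a' : X) (T (e a))‖ ^ 2 ≤ ∑ a, ‖adjoint T (e a)‖ ^ 2 := by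
    rw [Finset.sum_comm]
    refine Finset.sum_le_sum fun a _ => le_trans (le_of_eq ?_) (h2 a)
    exact Finset.sum_congr rfl fun a' _ => by rw [norm_inner_symm]
  rw [Finset.sum_sub_distrib]
  linarith

lemma re_inner_selfcomm {X : Type u} [NormedAddCommGroup X] [InnerProductSpace ℂ X]
    [CompleteSpace X] (T : X →L[ℂ] X) (x : X) :
    inner ℂ ((cmt (adjoint T) T) x) x = ((‖T x‖ ^ 2 - ‖adjoint T x‖ ^ 2 : ℝ) : ℂ) := by
  have h : (cmt (adjoint T) T) x = adjoint T (T x) - T (adjoint T x) := rfl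
  rw [h, inner_sub_left]
  rw [adjoint_inner_left, ← adjoint_inner_right T (adjoint T x) x, inner_self_eq_norm_sq_to_K,
    inner_self_eq_norm_sq_to_K]
  push_cast
  rfl

lemma hyponormal_iff_norm {X : Type u} [NormedAddCommGroup X] [InnerProductSpace ℂ X]
    [CompleteSpace X] (T : X →L[ℂ] X) :
    Hyponormal T ↔ ∀ x, ‖adjoint T x‖ ^ 2 ≤ ‖T x‖ ^ 2 := by
  unfold Hyponormal
  rw [isPositive_iff_complex]
  refine forall_congr' fun x => ?_
  rw [re_inner_selfcomm, RCLike.re_eq_complex_re, Complex.ofReal_re]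
  simp only [true_and, sub_nonneg]

lemma exists_sqrt {X : Type u} [NormedAddCommGroup X] [InnerProductSpace ℂ X]
    [CompleteSpace X] (C : X →L[ℂ] X) (hC : C.IsPositive) :
    ∃ S : X →L[ℂ] X, ∀ x y, inner ℂ (C x) y = inner ℂ (S x) (S y) := by
  obtain ⟨S, hS⟩ := CStarAlgebra.nonneg_iff_eq_star_mul_self.mp
    ((nonneg_iff_isPositive C).mpr hC)
  refine ⟨S, fun x y => ?_⟩
  have h : C x = adjoint S (S x) := by rw [hS]; rfl
  rw [h, adjoint_inner_left]

/-- Hilbert-Schmidt monotonicity. -/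
lemma hs_mono {X : Type u} [NormedAddCommGroup X] [InnerProductSpace ℂ X]
    [CompleteSpace X] (S : X →L[ℂ] X) {M : Submodule ℂ X} [FiniteDimensional ℂ M]
    {ι κ : Type*} [Fintype ι] [Fintype κ] (e : OrthonormalBasis ι ℂ M) {f : κ → X}
    (hf : Orthonormal ℂ f) :
    ∑ i, ‖S (M.starProjection (f i))‖ ^ 2 ≤ ∑ a, ‖S (e a)‖ ^ 2 := by
  set g := stdOrthonormalBasis ℂ ↥(M.map (S : X →ₗ[ℂ] X)) with hg
  have hmem : ∀ y ∈ M, S y ∈ M.map (S : X →ₗ[ℂ] X) := fun y hy => ⟨y, hy, rfl⟩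
  have h1 : ∀ i, ‖S (M.starProjection (f i))‖ ^ 2
      = ∑ b, ‖inner ℂ (f i) (M.starProjection (adjoint S (g b)))‖ ^ 2 := by
    intro i
    rw [← onb_sum_mem g (hmem _ (M.starProjection_apply_mem (f i)))]
    refine Finset.sum_congr rfl fun b _ => ?_
    rw [← adjoint_inner_left, norm_inner_symm, Submodule.inner_starProjection_left_eq_right]
  have h2 : ∀ a, ‖S (e a)‖ ^ 2 = ∑ b, ‖inner ℂ (e a : X) (adjoint S (g b))‖ ^ 2 := by
    intro a
    rw [← onb_sum_mem g (hmem _ (e a).2)]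
    refine Finset.sum_congr rfl fun b _ => ?_
    rw [← adjoint_inner_left, norm_inner_symm]
  simp only [h1, h2]
  rw [Finset.sum_comm, Finset.sum_comm (s := Finset.univ (α := ι))]
  refine Finset.sum_le_sum fun b _ => ?_
  rw [onb_sum_proj e]
  exact hf.sum_inner_products_le _

lemma norm_sub_proj_le {X : Type u} [NormedAddCommGroup X] [InnerProductSpace ℂ X]
    {M : Submodule ℂ X} [M.HasOrthogonalProjection] (x : X) {y : X} (hy : y ∈ M) :
    ‖M.starProjection x - x‖ ≤ ‖y - x‖ := by
  rw [norm_sub_rev, norm_sub_rev y, Submodule.starProjection_minimal]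
  exact ciInf_le (f := fun w : M => ‖x - w‖) ⟨0, by rintro _ ⟨w, rfl⟩; positivity⟩ ⟨y, hy⟩

/-- The space of all polynomials in `T` applied to the vectors `x k`. -/
def cycAll {X : Type u} [NormedAddCommGroup X] [InnerProductSpace ℂ X] {m : ℕ}
    (T : X →L[ℂ] X) (x : Fin m → X) : Submodule ℂ X :=
  Submodule.span ℂ (Set.range fun p : Fin m × ℕ => (T ^ p.2) (x p.1))

/-- The space of polynomials of degree less than `N` in `T` applied to the vectors `x k`. -/
def cycV {X : Type u} [NormedAddCommGroup X] [InnerProductSpace ℂ X] {m : ℕ}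
    (T : X →L[ℂ] X) (x : Fin m → X) (N : ℕ) : Submodule ℂ X :=
  Submodule.span ℂ (Set.range fun p : Fin m × Fin N => (T ^ (p.2 : ℕ)) (x p.1))

/-- Rational functions of `T`, with poles off `L`, applied to the vectors `x k`. -/
def ratD {X : Type u} [NormedAddCommGroup X] [InnerProductSpace ℂ X] {m : ℕ}
    (T : X →L[ℂ] X) (x : Fin m → X) (L : Set ℂ) : Set X :=
  {y | ∃ q : Polynomial ℂ, (∀ z ∈ L, q.eval z ≠ 0) ∧ IsUnit (Polynomial.aeval T q) ∧
    Polynomial.aeval T q y ∈ cycAll T x}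

section
variable {X : Type u} [NormedAddCommGroup X] [InnerProductSpace ℂ X] {m : ℕ}

lemma cycAll_apply (T : X →L[ℂ] X) (x : Fin m → X) {y : X} (hy : y ∈ cycAll T x) :
    T y ∈ cycAll T x := by
  refine Submodule.span_induction (p := fun y _ => T y ∈ cycAll T x) ?_ ?_ ?_ ?_ hy
  · rintro _ ⟨p, rfl⟩
    refine Submodule.subset_span ⟨(p.1, p.2 + 1), ?_⟩
    simp only [pow_succ']
    rfl
  · simp
  · intro a b _ _ ha hb
    rw [map_add]
    exact add_mem ha hb
  · intro c a _ ha
    rw [map_smul]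
    exact Submodule.smul_mem _ _ ha

lemma cycAll_aeval (T : X →L[ℂ] X) (x : Fin m → X) (q : Polynomial ℂ) {y : X}
    (hy : y ∈ cycAll T x) : Polynomial.aeval T q y ∈ cycAll T x := by
  induction q using Polynomial.induction_on' with
  | add p q hp hq =>
    rw [map_add]
    exact add_mem hp hq
  | monomial n a =>
    rw [Polynomial.aeval_monomial, ← Algebra.smul_def]
    refine Submodule.smul_mem _ a ?_
    induction n with
    | zero => simpa using hy
    | succ n ih =>
      rw [pow_succ']
      exact cycAll_apply T x ih

lemma cycV_mono (T : X →L[ℂ] X) (x : Fin m → X) {N N' : ℕ} (h : N ≤ N') :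
    cycV T x N ≤ cycV T x N' := by
  refine Submodule.span_mono ?_
  rintro _ ⟨p, rfl⟩
  exact ⟨(p.1, Fin.castLE h p.2), rfl⟩

lemma exists_cycV (T : X →L[ℂ] X) (x : Fin m → X) {y : X} (hy : y ∈ cycAll T x) :
    ∃ N, y ∈ cycV T x N := by
  refine Submodule.span_induction (p := fun y _ => ∃ N, y ∈ cycV T x N) ?_ ?_ ?_ ?_ hy
  · rintro _ ⟨p, rfl⟩
    exact ⟨p.2 + 1, Submodule.subset_span ⟨(p.1, ⟨p.2, by omega⟩), rfl⟩⟩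
  · exact ⟨0, zero_mem _⟩
  · rintro a b _ _ ⟨N, hN⟩ ⟨N', hN'⟩
    exact ⟨max N N', add_mem (cycV_mono T x (le_max_left _ _) hN)
      (cycV_mono T x (le_max_right _ _) hN')⟩
  · rintro c a _ ⟨N, hN⟩
    exact ⟨N, Submodule.smul_mem _ _ hN⟩

lemma cycV_apply (T : X →L[ℂ] X) (x : Fin m → X) (N : ℕ) {y : X} (hy : y ∈ cycV T x N) :
    T y ∈ cycV T x (N + 1) := by
  refine Submodule.span_induction (p := fun y _ => T y ∈ cycV T x (N + 1)) ?_ ?_ ?_ ?_ hy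
  · rintro _ ⟨p, rfl⟩
    refine Submodule.subset_span ⟨(p.1, p.2.succ), ?_⟩
    simp only [Fin.val_succ, pow_succ']
    rfl
  · simp
  · intro a b _ _ ha hb
    rw [map_add]
    exact add_mem ha hb
  · intro c a _ ha
    rw [map_smul]
    exact Submodule.smul_mem _ _ ha

instance cycV_fd (T : X →L[ℂ] X) (x : Fin m → X) (N : ℕ) : FiniteDimensional ℂ (cycV T x N) :=
  FiniteDimensional.span_of_finite ℂ (Set.finite_range _)

lemma cycV_finrank (T : X →L[ℂ] X) (x : Fin m → X) (N : ℕ) :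
    Module.finrank ℂ (cycV T x (N + 1)) ≤ Module.finrank ℂ (cycV T x N) + m := by
  set W := Submodule.span ℂ (Set.range fun k : Fin m => (T ^ N) (x k)) with hW
  have : FiniteDimensional ℂ W := FiniteDimensional.span_of_finite ℂ (Set.finite_range _)
  have hle : cycV T x (N + 1) ≤ cycV T x N ⊔ W := by
    refine Submodule.span_le.mpr ?_
    rintro _ ⟨⟨k, n⟩, rfl⟩
    rcases Nat.lt_succ_iff_lt_or_eq.mp n.2 with h | h
    · exact Submodule.mem_sup_left (Submodule.subset_span ⟨(k, ⟨n, h⟩), rfl⟩)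
    · refine Submodule.mem_sup_right (Submodule.subset_span ⟨k, ?_⟩)
      simp only [h]
  have h1 : Module.finrank ℂ W ≤ m := by
    have := finrank_range_le_card (R := ℂ) (fun k : Fin m => (T ^ N) (x k))
    simpa [Set.finrank] using this
  have h2 := Submodule.finrank_mono hle
  have h3 := Submodule.finrank_add_le_finrank_add_finrank (cycV T x N) W
  omega

lemma common_denominator (T : X →L[ℂ] X) (x : Fin m → X) (L : Set ℂ) {κ : Type*}
    (y : κ → X) (hy : ∀ i, y i ∈ ratD T x L) (s : Finset κ) :
    ∃ q : Polynomial ℂ, IsUnit (Polynomial.aeval T q) ∧ ∃ N, ∀ i ∈ s,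
      Polynomial.aeval T q (y i) ∈ cycV T x N := by
  classical
  have key : ∃ q : Polynomial ℂ, IsUnit (Polynomial.aeval T q) ∧ ∀ i ∈ s,
      Polynomial.aeval T q (y i) ∈ cycAll T x := by
    induction s using Finset.induction_on with
    | empty => exact ⟨1, by simp, by simp⟩
    | insert a s _ ih =>
      obtain ⟨q, hq, hqs⟩ := ih
      obtain ⟨q', -, hq', hmem⟩ := hy a
      refine ⟨q * q', ?_, ?_⟩
      · rw [map_mul]
        exact hq.mul hq'
      · intro i hi
        rcases Finset.mem_insert.mp hi with rfl | hi
        · rw [map_mul]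
          exact cycAll_aeval T x q hmem
        · rw [mul_comm, map_mul]
          exact cycAll_aeval T x q' (hqs i hi)
  obtain ⟨q, hq, hqs⟩ := key
  refine ⟨q, hq, ?_⟩
  clear hy hq
  induction s using Finset.induction_on with
  | empty => exact ⟨0, by simp⟩
  | insert a s _ ih =>
    obtain ⟨N, hN⟩ := ih fun i hi => hqs i (Finset.mem_insert_of_mem hi)
    obtain ⟨N', hN'⟩ := exists_cycV T x (hqs a (Finset.mem_insert_self a s))
    refine ⟨max N N', fun i hi => ?_⟩
    rcases Finset.mem_insert.mp hi with rfl | hi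
    · exact cycV_mono T x (le_max_right _ _) hN'
    · exact cycV_mono T x (le_max_left _ _) (hN i hi)

/-- The norm version of the Berger-Shaw inequality for rationally cyclic operators. -/
lemma trace_le_of_rat [CompleteSpace X] (T : X →L[ℂ] X)
    (hT : Hyponormal T) (x : Fin m → X) (L : Set ℂ) (hD : Dense (ratD T x L))
    {κ : Type*} [Fintype κ] {f : κ → X} (hf : Orthonormal ℂ f) :
    ∑ i, (‖T (f i)‖ ^ 2 - ‖adjoint T (f i)‖ ^ 2) ≤ m * ‖T‖ ^ 2 := by
  set F : (κ → X) → ℝ := fun y => ∑ i, (‖T (y i)‖ ^ 2 - ‖adjoint T (y i)‖ ^ 2) with hF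
  have hFc : Continuous F := by fun_prop
  refine le_of_forall_pos_le_add fun ε hε => ?_
  obtain ⟨δ, hδ, hδF⟩ := Metric.continuous_iff.mp hFc f ε hε
  have hy : ∀ i, ∃ y ∈ ratD T x L, dist y (f i) < δ := fun i => by
    obtain ⟨y, hy, hyD⟩ := Metric.dense_iff.mp hD (f i) δ hδ
    exact ⟨y, hyD, hy⟩
  choose y hyD hyδ using hy
  obtain ⟨q, hq, N, hN⟩ := common_denominator T x L y hyD Finset.univ
  obtain ⟨u, hu⟩ := hq
  set Q : X →L[ℂ] X := Polynomial.aeval T q with hQ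
  set R : X →L[ℂ] X := ((u⁻¹ : (X →L[ℂ] X)ˣ) : X →L[ℂ] X) with hR
  have hRQ : ∀ z, R (Q z) = z := fun z => by
    have : R * Q = 1 := by rw [← hu]; exact u.inv_mul
    exact congrArg (fun A : X →L[ℂ] X => A z) this
  have hQR : ∀ z, Q (R z) = z := fun z => by
    have : Q * R = 1 := by rw [← hu]; exact u.mul_inv
    exact congrArg (fun A : X →L[ℂ] X => A z) this
  have hTQ : ∀ z, T (Q z) = Q (T z) := fun z => by
    have : T * Q = Q * T := by
      have h : T = Polynomial.aeval T (Polynomial.X : Polynomial ℂ) := by simp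
      rw [hQ]
      nth_rewrite 1 [h]
      nth_rewrite 4 [h]
      rw [← map_mul, ← map_mul, mul_comm]
    exact congrArg (fun A : X →L[ℂ] X => A z) this
  have hTR : ∀ z, T (R z) = R (T z) := fun z => by
    rw [← hRQ (T (R z)), ← hTQ, hQR]
  set M : Submodule ℂ X := (cycV T x N).map (R : X →ₗ[ℂ] X) with hM
  set M' : Submodule ℂ X := (cycV T x (N + 1)).map (R : X →ₗ[ℂ] X) with hM'
  have hRinj : Function.Injective (R : X →ₗ[ℂ] X) := fun a b hab => by
    have : R a = R b := hab
    rw [← hQR a, this, hQR]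
  have hMM' : M ≤ M' := Submodule.map_mono (cycV_mono T x (Nat.le_succ N))
  have hTM : ∀ z ∈ M, T z ∈ M' := by
    rintro _ ⟨w, hw, rfl⟩
    exact ⟨T w, cycV_apply T x N hw, (hTR w).symm⟩
  have hfr : Module.finrank ℂ M' ≤ Module.finrank ℂ M + m := by
    rw [hM, hM', ← (Submodule.equivMapOfInjective _ hRinj (cycV T x N)).finrank_eq,
      ← (Submodule.equivMapOfInjective _ hRinj (cycV T x (N + 1))).finrank_eq]
    exact cycV_finrank T x N
  have hyM : ∀ i, y i ∈ M := fun i => ⟨Q (y i), hN i (Finset.mem_univ i), hRQ _⟩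
  set e := stdOrthonormalBasis ℂ M
  have h1 := trace_fd_le T hMM' hTM hfr e
  obtain ⟨S, hS⟩ := exists_sqrt _ hT
  have hS' : ∀ z, ‖S z‖ ^ 2 = ‖T z‖ ^ 2 - ‖adjoint T z‖ ^ 2 := fun z => by
    have h := hS z z
    rw [re_inner_selfcomm, inner_self_eq_norm_sq_to_K] at h
    rw [← RCLike.ofReal_pow] at h
    exact (Complex.ofReal_injective h).symm
  have h2 := hs_mono S e hf
  simp only [hS'] at h2
  have h3 : dist (F fun i => M.starProjection (f i)) (F f) < ε := by
    apply hδF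
    rw [dist_pi_lt_iff hδ]
    intro i
    rw [dist_eq_norm]
    refine (norm_sub_proj_le (f i) (hyM i)).trans_lt ?_
    rw [← dist_eq_norm]
    exact hyδ i
  rw [Real.dist_eq, abs_lt] at h3
  have h4 : F (fun i => M.starProjection (f i)) ≤ m * ‖T‖ ^ 2 := h2.trans h1
  linarith [h3.1]

end

/-- Powers of an element with spectrum in the open unit disc tend to zero. -/
lemma pow_norm_tendsto {A : Type u} [NormedRing A] [NormedAlgebra ℂ A] [CompleteSpace A]
    (b : A) (hb : ∀ z ∈ spectrum ℂ b, ‖z‖ < 1) :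
    Filter.Tendsto (fun n : ℕ => ‖b ^ n‖) Filter.atTop (nhds 0) := by
  rcases subsingleton_or_nontrivial A with hA | hA
  · have : ∀ n : ℕ, ‖b ^ n‖ = 0 := fun n => by rw [Subsingleton.elim (b ^ n) 0, norm_zero]
    simp [this]
  have h1 : spectralRadius ℂ b < ((1 : ℝ≥0) : ℝ≥0∞) :=
    spectrum.spectralRadius_lt_of_forall_lt b (fun z hz => by exact_mod_cast hb z hz)
  obtain ⟨r, hr1, hr2⟩ := ENNReal.lt_iff_exists_nnreal_btwn.mp h1
  have hr2' : r < 1 := by exact_mod_cast hr2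
  have h2 := (spectrum.pow_nnnorm_pow_one_div_tendsto_nhds_spectralRadius b).eventually_lt_const hr1
  refine squeeze_zero' (Filter.Eventually.of_forall fun n => norm_nonneg _) ?_
    (tendsto_pow_atTop_nhds_zero_of_lt_one r.2 (show (r : ℝ) < 1 from hr2'))
  filter_upwards [h2, Filter.eventually_gt_atTop 0] with n hn hn0
  have hn0' : (0 : ℝ) < n := by exact_mod_cast hn0
  have h3 : ((‖b ^ n‖₊ : ℝ≥0∞) ^ (1 / (n : ℝ))) ^ (n : ℝ) ≤ (r : ℝ≥0∞) ^ (n : ℝ) :=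
    ENNReal.rpow_le_rpow hn.le hn0'.le
  rw [← ENNReal.rpow_mul, one_div, inv_mul_cancel₀ hn0'.ne', ENNReal.rpow_one,
    ENNReal.rpow_natCast] at h3
  have h4 : ‖b ^ n‖₊ ≤ r ^ n := by exact_mod_cast h3
  exact_mod_cast h4

/-- The direct sum of two operators. -/
def dsum {X : Type u} [NormedAddCommGroup X] [InnerProductSpace ℂ X]
    {Y : Type} [NormedAddCommGroup Y] [InnerProductSpace ℂ Y]
    (T : X →L[ℂ] X) (S : Y →L[ℂ] Y) : WithLp 2 (X × Y) →L[ℂ] WithLp 2 (X × Y) :=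
  ((WithLp.prodContinuousLinearEquiv 2 ℂ X Y).symm : X × Y →L[ℂ] WithLp 2 (X × Y)).comp
    ((T.prodMap S).comp ((WithLp.prodContinuousLinearEquiv 2 ℂ X Y) : WithLp 2 (X × Y) →L[ℂ] X × Y))

section
variable {X : Type u} [NormedAddCommGroup X] [InnerProductSpace ℂ X]
variable {Y : Type} [NormedAddCommGroup Y] [InnerProductSpace ℂ Y]

lemma dsum_fst (T : X →L[ℂ] X) (S : Y →L[ℂ] Y) (z : WithLp 2 (X × Y)) :
    (dsum T S z).fst = T z.fst := rfl

lemma dsum_snd (T : X →L[ℂ] X) (S : Y →L[ℂ] Y) (z : WithLp 2 (X × Y)) :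
    (dsum T S z).snd = S z.snd := rfl

lemma dsum_mul (T T' : X →L[ℂ] X) (S S' : Y →L[ℂ] Y) :
    dsum T S * dsum T' S' = dsum (T * T') (S * S') := rfl

lemma dsum_one : dsum (1 : X →L[ℂ] X) (1 : Y →L[ℂ] Y) = 1 := rfl

lemma dsum_pow (T : X →L[ℂ] X) (S : Y →L[ℂ] Y) (n : ℕ) : dsum T S ^ n = dsum (T ^ n) (S ^ n) := by
  induction n with
  | zero => simp [dsum_one]
  | succ n ih => rw [pow_succ, ih, dsum_mul, pow_succ, pow_succ]

lemma dsum_add (T T' : X →L[ℂ] X) (S S' : Y →L[ℂ] Y) :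
    dsum T S + dsum T' S' = dsum (T + T') (S + S') := rfl

lemma dsum_smul (c : ℂ) (T : X →L[ℂ] X) (S : Y →L[ℂ] Y) :
    c • dsum T S = dsum (c • T) (c • S) := rfl

lemma dsum_aeval (T : X →L[ℂ] X) (S : Y →L[ℂ] Y) (q : Polynomial ℂ) :
    Polynomial.aeval (dsum T S) q = dsum (Polynomial.aeval T q) (Polynomial.aeval S q) := by
  induction q using Polynomial.induction_on' with
  | add p q hp hq => rw [map_add, map_add, map_add, hp, hq, dsum_add]
  | monomial n a =>
    simp only [Polynomial.aeval_monomial, ← Algebra.smul_def]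
    rw [dsum_pow, dsum_smul]

lemma dsum_isUnit {T : X →L[ℂ] X} {S : Y →L[ℂ] Y} (hT : IsUnit T) (hS : IsUnit S) :
    IsUnit (dsum T S) := by
  obtain ⟨u, rfl⟩ := hT
  obtain ⟨v, rfl⟩ := hS
  refine ⟨⟨dsum u v, dsum (u⁻¹ : (X →L[ℂ] X)ˣ) (v⁻¹ : (Y →L[ℂ] Y)ˣ), ?_, ?_⟩, rfl⟩
  · rw [dsum_mul, u.mul_inv, v.mul_inv, dsum_one]
  · rw [dsum_mul, u.inv_mul, v.inv_mul, dsum_one]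

lemma dsum_adjoint [CompleteSpace X] [CompleteSpace Y] (T : X →L[ℂ] X) (S : Y →L[ℂ] Y) :
    adjoint (dsum T S) = dsum (adjoint T) (adjoint S) := by
  symm
  rw [eq_adjoint_iff]
  intro x y
  rw [WithLp.prod_inner_apply, WithLp.prod_inner_apply]
  change inner ℂ (adjoint T x.fst) y.fst + inner ℂ (adjoint S x.snd) y.snd
    = inner ℂ x.fst (T y.fst) + inner ℂ x.snd (S y.snd)
  rw [adjoint_inner_left, adjoint_inner_left]

lemma dsum_norm_sq (T : X →L[ℂ] X) (S : Y →L[ℂ] Y) (z : WithLp 2 (X × Y)) :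
    ‖dsum T S z‖ ^ 2 = ‖T z.fst‖ ^ 2 + ‖S z.snd‖ ^ 2 := by
  rw [WithLp.prod_norm_sq_eq_of_L2, dsum_fst, dsum_snd]

lemma dsum_norm_le (T : X →L[ℂ] X) (S : Y →L[ℂ] Y) {R : ℝ} (hT : ‖T‖ ≤ R) (hS : ‖S‖ ≤ R) :
    ‖dsum T S‖ ≤ R := by
  have hR : 0 ≤ R := (norm_nonneg _).trans hT
  refine opNorm_le_bound _ hR fun z => ?_
  rw [← abs_of_nonneg (norm_nonneg (dsum T S z)), ← abs_of_nonneg (mul_nonneg hR (norm_nonneg z)),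
    ← sq_le_sq, dsum_norm_sq, mul_pow, WithLp.prod_norm_sq_eq_of_L2, mul_add, ← mul_pow, ← mul_pow]
  have h1 := T.le_of_opNorm_le hT z.fst
  have h2 := S.le_of_opNorm_le hS z.snd
  gcongr

lemma dsum_hyponormal [CompleteSpace X] [CompleteSpace Y] {T : X →L[ℂ] X} {S : Y →L[ℂ] Y}
    (hT : Hyponormal T) (hS : Hyponormal S) : Hyponormal (dsum T S) := by
  rw [hyponormal_iff_norm] at *
  intro z
  rw [dsum_adjoint, dsum_norm_sq, dsum_norm_sq]
  exact add_le_add (hT _) (hS _)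

lemma dsum_spectrum (T : X →L[ℂ] X) (S : Y →L[ℂ] Y) :
    spectrum ℂ (dsum T S) ⊆ spectrum ℂ T ∪ spectrum ℂ S := by
  intro z hz
  by_contra hcon
  rw [Set.mem_union, not_or, spectrum.notMem_iff, spectrum.notMem_iff] at hcon
  apply hz
  exact dsum_isUnit hcon.1 hcon.2

lemma spectrum_disc [CompleteSpace Y] (U : Y →L[ℂ] Y) (hU : ‖U‖ ≤ 1) (a : ℂ) {ρ : ℝ} (hρ : 0 < ρ) :
    spectrum ℂ (a • (1 : Y →L[ℂ] Y) + (ρ : ℂ) • U) ⊆ Metric.closedBall a ρ := by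
  intro z hz
  have h1 : z - a ∈ spectrum ℂ ((ρ : ℂ) • U) := by
    intro hu
    apply hz
    have : (algebraMap ℂ (Y →L[ℂ] Y)) z - (a • (1 : Y →L[ℂ] Y) + (ρ : ℂ) • U)
        = (algebraMap ℂ (Y →L[ℂ] Y)) (z - a) - (ρ : ℂ) • U := by
      rw [map_sub, Algebra.algebraMap_eq_smul_one, Algebra.algebraMap_eq_smul_one]
      abel
    change IsUnit _
    rw [this]
    exact hu
  have h2 := spectrum.subset_closedBall_norm_mul ((ρ : ℂ) • U) h1
  rw [mem_closedBall_zero_iff] at h2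
  rw [mem_closedBall_iff_norm]
  refine h2.trans ?_
  have h3 : ‖(1 : Y →L[ℂ] Y)‖ ≤ 1 := norm_id_le
  have h4 : ‖(ρ : ℂ) • U‖ ≤ ρ := by
    rw [norm_smul, Complex.norm_real, Real.norm_of_nonneg hρ.le]
    nlinarith
  calc _ ≤ ρ * 1 := mul_le_mul h4 h3 (norm_nonneg _) hρ.le
    _ = ρ := mul_one ρ

lemma isUnit_aeval_of [CompleteSpace Y] (S : Y →L[ℂ] Y) (q : Polynomial ℂ)
    (hq : ∀ z ∈ spectrum ℂ S, q.eval z ≠ 0) : IsUnit (Polynomial.aeval S q) := by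
  rcases subsingleton_or_nontrivial (Y →L[ℂ] Y) with hA | hA
  · exact isUnit_of_subsingleton _
  · rw [← spectrum.zero_notMem_iff ℂ, spectrum.map_polynomial_aeval]
    rintro ⟨z, hz, h0⟩
    exact hq z hz h0

end
/-- The model space carrying the unilateral shift of multiplicity `m`. -/
abbrev ShiftSpace (m : ℕ) : Type := lp (fun _ : Fin m × ℕ => ℂ) 2

/-- The model operator of a disc: a shift of multiplicity `m`. -/
lemma exists_shift (m : ℕ) : ∃ (U : ShiftSpace m →L[ℂ] ShiftSpace m) (w : Fin m → ShiftSpace m),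
    (∀ y, ‖U y‖ = ‖y‖) ∧ Orthonormal ℂ w ∧ (∀ k, adjoint U (w k) = 0) ∧
    (∀ V : Submodule ℂ (ShiftSpace m), (∀ k, w k ∈ V) → (∀ y ∈ V, U y ∈ V) →
      Dense (V : Set (ShiftSpace m))) := by
  classical
  set b : Fin m × ℕ → ShiftSpace m := fun p => lp.single 2 p (1 : ℂ) with hb
  have hbo : Orthonormal ℂ b := by
    rw [orthonormal_iff_ite]
    intro i j
    rw [hb, lp.inner_single_left]
    simp only [lp.single_apply]
    by_cases h : i = j
    · subst h; simp
    · simp [h]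
  set s : Fin m × ℕ → Fin m × ℕ := fun p => (p.1, p.2 + 1) with hs
  have hsinj : Function.Injective s := by
    rintro ⟨k, n⟩ ⟨k', n'⟩ h
    simp only [hs, Prod.mk.injEq, add_left_inj] at h
    exact Prod.ext h.1 h.2
  have hso : Orthonormal ℂ (b ∘ s) := hbo.comp s hsinj
  set U₀ := hso.orthogonalFamily.linearIsometry with hU₀
  set U : ShiftSpace m →L[ℂ] ShiftSpace m := U₀.toContinuousLinearMap with hU
  have hUb : ∀ p, U (b p) = b (s p) := fun p => by
    have := hso.orthogonalFamily.linearIsometry_apply_single (i := p) (1 : ℂ)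
    refine this.trans ?_
    simp
  have hdense : ∀ V : Submodule ℂ (ShiftSpace m), (∀ p, b p ∈ V) →
      Dense (V : Set (ShiftSpace m)) := by
    intro V hV y
    have hy := lp.hasSum_single (p := 2) (by simp) y
    refine mem_closure_of_tendsto hy (Filter.Eventually.of_forall fun t => ?_)
    refine Submodule.sum_mem _ fun p _ => ?_
    have : lp.single 2 p (y p) = (y p) • b p := by
      rw [hb, ← lp.single_smul]
      simp
    rw [this]
    exact V.smul_mem _ (hV p)
  refine ⟨U, fun k => b (k, 0), fun y => U₀.norm_map y, ?_, ?_, ?_⟩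
  · exact hbo.comp (fun k => (k, 0)) fun k k' h => (Prod.mk.inj h).1
  · intro k
    have hker := hdense (LinearMap.ker ((innerSL ℂ (adjoint U (b (k, 0))) :
      ShiftSpace m →L[ℂ] ℂ) : ShiftSpace m →ₗ[ℂ] ℂ)) (fun p => by
        rw [LinearMap.mem_ker]
        change inner ℂ (adjoint U (b (k, 0))) (b p) = 0
        rw [adjoint_inner_left, hUb]
        exact hbo.2 (by simp [hs]))
    have hz : (innerSL ℂ (adjoint U (b (k, 0))) : ShiftSpace m →L[ℂ] ℂ) = 0 := by
      refine DFunLike.coe_injective (Continuous.ext_on hker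
        (innerSL ℂ (adjoint U (b (k, 0)))).continuous continuous_zero ?_)
      intro y hy
      exact LinearMap.mem_ker.mp hy
    have := congrArg (fun A : ShiftSpace m →L[ℂ] ℂ => A (adjoint U (b (k, 0)))) hz
    exact inner_self_eq_zero.mp this
  · intro V hV1 hV2
    refine hdense V ?_
    rintro ⟨k, n⟩
    induction n with
    | zero => exact hV1 k
    | succ n ih =>
      have := hV2 _ ih
      rwa [hUb] at this

lemma exists_disc_op (m : ℕ) (a : ℂ) {ρ : ℝ} (hρ : 0 < ρ) :
    ∃ (U : ShiftSpace m →L[ℂ] ShiftSpace m) (w : Fin m → ShiftSpace m), ‖U‖ ≤ 1 ∧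
      Orthonormal ℂ w ∧ Hyponormal (a • (1 : ShiftSpace m →L[ℂ] ShiftSpace m) + (ρ : ℂ) • U) ∧
      (∀ k, ‖(a • (1 : ShiftSpace m →L[ℂ] ShiftSpace m) + (ρ : ℂ) • U) (w k)‖ ^ 2
        - ‖adjoint (a • (1 : ShiftSpace m →L[ℂ] ShiftSpace m) + (ρ : ℂ) • U) (w k)‖ ^ 2 = ρ ^ 2) ∧
      Dense (cycAll (a • (1 : ShiftSpace m →L[ℂ] ShiftSpace m) + (ρ : ℂ) • U) w :
        Set (ShiftSpace m)) := by
  obtain ⟨U, w, hU, hw, hUw, hd⟩ := exists_shift m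
  have hU1 : ‖U‖ ≤ 1 := opNorm_le_bound _ zero_le_one fun y => by rw [hU, one_mul]
  set S := a • (1 : ShiftSpace m →L[ℂ] ShiftSpace m) + (ρ : ℂ) • U with hS
  have hSy : ∀ y, S y = a • y + (ρ : ℂ) • U y := fun y => rfl
  have hSa : ∀ y, adjoint S y = (starRingEnd ℂ a) • y + (ρ : ℂ) • adjoint U y := fun y => by
    refine ext_inner_right ℂ fun v => ?_
    rw [adjoint_inner_left, hSy]
    simp only [inner_add_left, inner_add_right, inner_smul_left, inner_smul_right,
      adjoint_inner_left, Complex.conj_ofReal, Complex.conj_conj]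
  have hdiff : ∀ y, ‖S y‖ ^ 2 - ‖adjoint S y‖ ^ 2 = ρ ^ 2 * (‖y‖ ^ 2 - ‖adjoint U y‖ ^ 2) := by
    intro y
    rw [hSy, hSa, norm_add_sq (𝕜 := ℂ), norm_add_sq (𝕜 := ℂ)]
    have hin : RCLike.re (inner ℂ (a • y) ((ρ : ℂ) • U y))
        = RCLike.re (inner ℂ ((starRingEnd ℂ a) • y) ((ρ : ℂ) • adjoint U y)) := by
      rw [← inner_conj_symm, RCLike.conj_re]
      simp only [adjoint_inner_right, map_smul, inner_smul_left, inner_smul_right, Complex.conj_ofReal,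
        Complex.conj_conj]
      congr 1
      ring
    rw [hin]
    simp only [norm_smul, RCLike.norm_conj, Complex.norm_real, Real.norm_of_nonneg hρ.le, hU]
    ring
  refine ⟨U, w, hU1, hw, ?_, ?_, ?_⟩
  · rw [hyponormal_iff_norm]
    intro y
    have h1 := hdiff y
    have h2 : ‖adjoint U y‖ ≤ ‖y‖ := by
      have := (adjoint U).le_of_opNorm_le (c := 1) (by rwa [LinearIsometryEquiv.norm_map]) y
      rwa [one_mul] at this
    have h3 : 0 ≤ ρ ^ 2 * (‖y‖ ^ 2 - ‖adjoint U y‖ ^ 2) := by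
      have : ‖adjoint U y‖ ^ 2 ≤ ‖y‖ ^ 2 := by gcongr
      have : 0 ≤ ‖y‖ ^ 2 - ‖adjoint U y‖ ^ 2 := by linarith
      positivity
    linarith
  · intro k
    rw [hdiff, hUw, hw.1 k]
    simp
  · refine hd _ (fun k => Submodule.subset_span ⟨(k, 0), by simp⟩) fun y hy => ?_
    have h1 : S y ∈ cycAll S w := cycAll_apply S w hy
    have hρ' : (ρ : ℂ) ≠ 0 := by exact_mod_cast hρ.ne'
    have h2 : U y = (ρ : ℂ)⁻¹ • (S y - a • y) := by
      rw [hSy, add_sub_cancel_left, smul_smul, inv_mul_cancel₀ hρ', one_smul]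
    rw [h2]
    exact Submodule.smul_mem _ _ (Submodule.sub_mem _ h1 (Submodule.smul_mem _ _ hy))

section
variable {X : Type u} [NormedAddCommGroup X] [InnerProductSpace ℂ X] {m : ℕ}

/-- `ratD` as a submodule. -/
def ratSub (T : X →L[ℂ] X) (x : Fin m → X) (L : Set ℂ) : Submodule ℂ X where
  carrier := ratD T x L
  zero_mem' := ⟨1, by simp, by simp, by simp⟩
  add_mem' := by
    rintro a b ⟨q, hq1, hq2, hq3⟩ ⟨q', hq1', hq2', hq3'⟩
    refine ⟨q * q', fun z hz => ?_, ?_, ?_⟩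
    · rw [Polynomial.eval_mul]
      exact mul_ne_zero (hq1 z hz) (hq1' z hz)
    · rw [map_mul]
      exact hq2.mul hq2'
    · rw [map_add]
      refine add_mem ?_ ?_
      · rw [mul_comm, map_mul]
        exact cycAll_aeval T x q' hq3
      · rw [map_mul]
        exact cycAll_aeval T x q hq3'
  smul_mem' := by
    rintro c a ⟨q, hq1, hq2, hq3⟩
    refine ⟨q, hq1, hq2, ?_⟩
    rw [map_smul]
    exact Submodule.smul_mem _ _ hq3

lemma mem_ratSub {T : X →L[ℂ] X} {x : Fin m → X} {L : Set ℂ} {y : X} :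
    y ∈ ratSub T x L ↔ y ∈ ratD T x L := Iff.rfl

lemma cycAll_le_ratSub (T : X →L[ℂ] X) (x : Fin m → X) (L : Set ℂ) {y : X}
    (hy : y ∈ cycAll T x) : y ∈ ratD T x L := ⟨1, by simp, by simp, by simpa using hy⟩

lemma ratD_div (T : X →L[ℂ] X) (x : Fin m → X) (L : Set ℂ) {y : X} (hy : y ∈ ratD T x L)
    (p : Polynomial ℂ) (hp : ∀ z ∈ L, p.eval z ≠ 0) (hpu : IsUnit (Polynomial.aeval T p)) :
    ∃ u ∈ ratD T x L, Polynomial.aeval T p u = y := by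
  obtain ⟨v, hv⟩ := hpu
  have h1 : Polynomial.aeval T p (((v⁻¹ : (X →L[ℂ] X)ˣ) : X →L[ℂ] X) y) = y := by
    have : Polynomial.aeval T p * ((v⁻¹ : (X →L[ℂ] X)ˣ) : X →L[ℂ] X) = 1 := by
      rw [← hv]; exact v.mul_inv
    exact congrArg (fun A : X →L[ℂ] X => A y) this
  obtain ⟨q, hq1, hq2, hq3⟩ := hy
  refine ⟨_, ⟨q * p, fun z hz => ?_, ?_, ?_⟩, h1⟩
  · rw [Polynomial.eval_mul]
    exact mul_ne_zero (hq1 z hz) (hp z hz)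
  · rw [map_mul]
    exact hq2.mul ⟨v, hv⟩
  · rw [map_mul]
    change Polynomial.aeval T q (Polynomial.aeval T p _) ∈ _
    rw [h1]
    exact hq3

/-- Affine rescaling of an operator. -/
def aff (a : ℂ) (s : ℝ) (T : X →L[ℂ] X) : X →L[ℂ] X := (s : ℂ)⁻¹ • (T - a • 1)

/-- The separating polynomial. -/
def sepPoly (a : ℂ) (s : ℝ) (n : ℕ) : Polynomial ℂ :=
  1 - (Polynomial.C (s : ℂ)⁻¹ * (Polynomial.X - Polynomial.C a)) ^ n

lemma sepPoly_aeval (a : ℂ) (s : ℝ) (n : ℕ) (T : X →L[ℂ] X) :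
    Polynomial.aeval T (sepPoly a s n) = 1 - aff a s T ^ n := by
  simp [sepPoly, aff, Algebra.algebraMap_eq_smul_one]

lemma sepPoly_eval (a : ℂ) {s : ℝ} (hs : 0 < s) {n : ℕ} (hn : n ≠ 0) {z : ℂ}
    (hz : ‖z - a‖ ≠ s) : (sepPoly a s n).eval z ≠ 0 := by
  intro h
  simp only [sepPoly, Polynomial.eval_sub, Polynomial.eval_one, Polynomial.eval_pow,
    Polynomial.eval_mul, Polynomial.eval_C, Polynomial.eval_X] at h
  have h1 : ((s : ℂ)⁻¹ * (z - a)) ^ n = 1 := (sub_eq_zero.mp h).symm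
  have h2 := Complex.norm_eq_one_of_pow_eq_one h1 hn
  rw [norm_mul, norm_inv, Complex.norm_real, Real.norm_of_nonneg hs.le] at h2
  apply hz
  field_simp at h2
  exact h2

lemma aff_inverse [CompleteSpace X] (a : ℂ) {s : ℝ} (hs : 0 < s) (T : X →L[ℂ] X)
    (h : ∀ z ∈ spectrum ℂ T, s < ‖z - a‖) :
    ∃ B : X →L[ℂ] X, B * aff a s T = 1 ∧ aff a s T * B = 1 ∧
      Filter.Tendsto (fun n : ℕ => ‖B ^ n‖) Filter.atTop (nhds 0) := by
  have hs' : (s : ℂ) ≠ 0 := by exact_mod_cast hs.ne'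
  have hsp : ∀ z ∈ spectrum ℂ (aff a s T), 1 < ‖z‖ := by
    intro z hz
    have hz' : a + s * z ∈ spectrum ℂ T := by
      intro hu
      apply hz
      have he : (algebraMap ℂ (X →L[ℂ] X)) z - aff a s T
          = (s : ℂ)⁻¹ • ((algebraMap ℂ (X →L[ℂ] X)) (a + s * z) - T) := by
        simp only [aff, Algebra.algebraMap_eq_smul_one, add_smul, mul_smul, smul_sub, smul_add]
        rw [smul_smul (s : ℂ)⁻¹ (s : ℂ), inv_mul_cancel₀ hs', one_smul]
        abel
      change IsUnit _
      rw [he]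
      exact (IsUnit.smul (Units.mk0 (s : ℂ)⁻¹ (inv_ne_zero hs')) hu)
    have := h _ hz'
    rw [add_sub_cancel_left, norm_mul, Complex.norm_real, Real.norm_of_nonneg hs.le] at this
    exact (lt_mul_iff_one_lt_right hs).mp this
  have hu : IsUnit (aff a s T) := by
    rw [← spectrum.zero_notMem_iff ℂ]
    intro h0
    have := hsp 0 h0
    simp at this
    linarith
  obtain ⟨v, hv⟩ := hu
  refine ⟨((v⁻¹ : (X →L[ℂ] X)ˣ) : X →L[ℂ] X), by rw [← hv]; exact v.inv_mul,
    by rw [← hv]; exact v.mul_inv, ?_⟩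
  refine pow_norm_tendsto _ fun z hz => ?_
  rw [← spectrum.map_inv, Set.mem_inv, hv] at hz
  have := hsp _ hz
  rw [norm_inv] at this
  by_contra hcon
  have h2 := inv_le_one_of_one_le₀ (not_lt.mp hcon)
  linarith

end

section
variable {X : Type u} [NormedAddCommGroup X] [InnerProductSpace ℂ X] [CompleteSpace X] {m : ℕ}
variable {Y : Type} [NormedAddCommGroup Y] [InnerProductSpace ℂ Y] [CompleteSpace Y]

lemma lift_fst (T : X →L[ℂ] X) (S : Y →L[ℂ] Y) (x : Fin m → X) (w : Fin m → Y) {v : X}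
    (hv : v ∈ cycAll T x) :
    ∃ z ∈ cycAll (dsum T S) (fun k => WithLp.toLp 2 (x k, w k)), z.fst = v := by
  refine Submodule.span_induction (p := fun v _ => ∃ z ∈ cycAll (dsum T S)
    (fun k => WithLp.toLp 2 (x k, w k)), z.fst = v) ?_ ?_ ?_ ?_ hv
  · rintro _ ⟨p, rfl⟩
    refine ⟨_, Submodule.subset_span ⟨p, rfl⟩, ?_⟩
    dsimp only
    rw [dsum_pow, dsum_fst]
    rfl
  · exact ⟨0, zero_mem _, rfl⟩
  · rintro _ _ _ _ ⟨z, hz, rfl⟩ ⟨z', hz', rfl⟩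
    exact ⟨z + z', add_mem hz hz', rfl⟩
  · rintro c _ _ ⟨z, hz, rfl⟩
    exact ⟨c • z, Submodule.smul_mem _ _ hz, rfl⟩

lemma lift_snd (T : X →L[ℂ] X) (S : Y →L[ℂ] Y) (x : Fin m → X) (w : Fin m → Y) {v : Y}
    (hv : v ∈ cycAll S w) :
    ∃ z ∈ cycAll (dsum T S) (fun k => WithLp.toLp 2 (x k, w k)), z.snd = v := by
  refine Submodule.span_induction (p := fun v _ => ∃ z ∈ cycAll (dsum T S)
    (fun k => WithLp.toLp 2 (x k, w k)), z.snd = v) ?_ ?_ ?_ ?_ hv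
  · rintro _ ⟨p, rfl⟩
    refine ⟨_, Submodule.subset_span ⟨p, rfl⟩, ?_⟩
    dsimp only
    rw [dsum_pow, dsum_snd]
    rfl
  · exact ⟨0, zero_mem _, rfl⟩
  · rintro _ _ _ _ ⟨z, hz, rfl⟩ ⟨z', hz', rfl⟩
    exact ⟨z + z', add_mem hz hz', rfl⟩
  · rintro c _ _ ⟨z, hz, rfl⟩
    exact ⟨c • z, Submodule.smul_mem _ _ hz, rfl⟩

/-- Separation of the two summands by rational functions. -/
lemma sep_snd (T : X →L[ℂ] X) (U : Y →L[ℂ] Y) (hU : ‖U‖ ≤ 1) (a : ℂ) {ρ s : ℝ} (hρ : 0 < ρ)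
    (hρs : ρ < s) (z₀ : Fin m → WithLp 2 (X × Y)) (L' : Set ℂ)
    (hL' : ∀ z ∈ L', s < ‖z - a‖) (hT : ∀ z ∈ spectrum ℂ T, s < ‖z - a‖)
    {y : WithLp 2 (X × Y)}
    (hy : y ∈ ratD (dsum T (a • (1 : Y →L[ℂ] Y) + (ρ : ℂ) • U)) z₀ L') :
    WithLp.toLp 2 ((0 : X), y.snd) ∈
      (ratSub (dsum T (a • (1 : Y →L[ℂ] Y) + (ρ : ℂ) • U)) z₀ L').topologicalClosure := by
  have hs : 0 < s := hρ.trans hρs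
  have hs' : (s : ℂ) ≠ 0 := by exact_mod_cast hs.ne'
  set S := a • (1 : Y →L[ℂ] Y) + (ρ : ℂ) • U with hS
  obtain ⟨B, hB1, hB2, hBt⟩ := aff_inverse a hs T hT
  set W := aff a s T with hW
  set C := aff a s S with hC
  have hCn : ‖C‖ ≤ ρ / s := by
    have : C = (s : ℂ)⁻¹ • ((ρ : ℂ) • U) := by
      rw [hC, aff, hS, add_sub_cancel_left]
    rw [this, norm_smul, norm_smul, norm_inv, Complex.norm_real, Complex.norm_real,
      Real.norm_of_nonneg hs.le, Real.norm_of_nonneg hρ.le, div_eq_inv_mul]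
    have : ρ * ‖U‖ ≤ ρ := by nlinarith
    gcongr
  have hρs1 : ρ / s < 1 := (div_lt_one hs).mpr hρs
  have hCt : Filter.Tendsto (fun n : ℕ => ‖C ^ n‖) Filter.atTop (nhds 0) := by
    refine squeeze_zero' (Filter.Eventually.of_forall fun n => norm_nonneg _) ?_
      (tendsto_pow_atTop_nhds_zero_of_lt_one (div_pos hρ hs).le hρs1)
    filter_upwards [Filter.eventually_gt_atTop 0] with n hn
    refine (norm_pow_le' C hn).trans ?_
    gcongr
  change _ ∈ closure (ratD (dsum T S) z₀ L')
  rw [Metric.mem_closure_iff]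
  intro ε hε
  obtain ⟨η, hη0, hη1, hη2⟩ : ∃ η : ℝ, 0 < η ∧ η ≤ 1 / 2 ∧
      2 * η * (‖y.fst‖ + ‖y.snd‖) < ε := by
    have hpos : 0 < 2 * (‖y.fst‖ + ‖y.snd‖) + 1 := by positivity
    refine ⟨min (1 / 2) (ε / (2 * (‖y.fst‖ + ‖y.snd‖) + 1)), by positivity, min_le_left _ _, ?_⟩
    have h1 : min (1 / 2) (ε / (2 * (‖y.fst‖ + ‖y.snd‖) + 1))
        ≤ ε / (2 * (‖y.fst‖ + ‖y.snd‖) + 1) := min_le_right _ _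
    rw [le_div_iff₀ hpos] at h1
    have h2 : 0 < min (1 / 2) (ε / (2 * (‖y.fst‖ + ‖y.snd‖) + 1)) := by positivity
    nlinarith
  obtain ⟨n, ⟨hn1, hn2⟩, hn0⟩ := (((hBt.eventually_lt_const hη0).and
    (hCt.eventually_lt_const hη0)).and (Filter.eventually_gt_atTop 0)).exists
  have hSspec := spectrum_disc U hU a hρ
  have hpu : IsUnit (Polynomial.aeval (dsum T S) (sepPoly a s n)) := by
    rw [dsum_aeval]
    refine dsum_isUnit ?_ ?_
    · have hc : Commute W B := hB2.trans hB1.symm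
      have hBW : B ^ n * W ^ n = 1 := by rw [← hc.symm.mul_pow, hB1, one_pow]
      have hWB : W ^ n * B ^ n = 1 := by rw [← hc.mul_pow, hB2, one_pow]
      have hone : IsUnit (1 - B ^ n) := by
        apply isUnit_one_sub_of_norm_lt_one
        linarith
      have hBu : IsUnit (W ^ n) := ⟨⟨W ^ n, B ^ n, hWB, hBW⟩, rfl⟩
      rw [sepPoly_aeval, ← hW]
      have : 1 - W ^ n = - (W ^ n * (1 - B ^ n)) := by
        rw [mul_sub, hWB, mul_one, neg_sub]
      rw [this]
      exact (hBu.mul hone).neg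
    · rw [sepPoly_aeval]
      apply isUnit_one_sub_of_norm_lt_one
      rw [← hC]
      linarith
  obtain ⟨u, huD, hu⟩ := ratD_div (dsum T S) z₀ L' hy (sepPoly a s n)
    (fun z hz => sepPoly_eval a hs hn0.ne' (hL' z hz).ne') hpu
  refine ⟨u, huD, ?_⟩
  rw [dsum_aeval, sepPoly_aeval, sepPoly_aeval, ← hW, ← hC] at hu
  have hu1 : u.fst - (W ^ n) u.fst = y.fst := by rw [← hu]; rfl
  have hu2 : u.snd - (C ^ n) u.snd = y.snd := by rw [← hu]; rfl
  have hBWu : (B ^ n) ((W ^ n) u.fst) = u.fst := by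
    have hc : Commute W B := hB2.trans hB1.symm
    have hBW : B ^ n * W ^ n = 1 := by rw [← hc.symm.mul_pow, hB1, one_pow]
    exact congrArg (fun A : X →L[ℂ] X => A u.fst) hBW
  have e1 : u.fst = (B ^ n) u.fst - (B ^ n) y.fst := by
    rw [← hu1, map_sub, hBWu]
    abel
  have n1 : ‖u.fst‖ ≤ η * ‖u.fst‖ + η * ‖y.fst‖ := by
    calc ‖u.fst‖ = ‖(B ^ n) u.fst - (B ^ n) y.fst‖ := by rw [← e1]
      _ ≤ ‖(B ^ n) u.fst‖ + ‖(B ^ n) y.fst‖ := norm_sub_le _ _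
      _ ≤ _ := add_le_add ((B ^ n).le_of_opNorm_le hn1.le _) ((B ^ n).le_of_opNorm_le hn1.le _)
  have e2 : u.snd - y.snd = (C ^ n) u.snd := by
    rw [← hu2]
    abel
  have n2 : ‖u.snd - y.snd‖ ≤ η * ‖u.snd‖ := by
    rw [e2]
    exact (C ^ n).le_of_opNorm_le hn2.le _
  have n3 : ‖u.snd‖ ≤ ‖y.snd‖ + ‖u.snd - y.snd‖ := by
    have := norm_add_le y.snd (u.snd - y.snd)
    rwa [add_sub_cancel] at this
  have n1' : ‖u.fst‖ ≤ 2 * η * ‖y.fst‖ := by nlinarith [norm_nonneg u.fst]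
  have n2' : ‖u.snd - y.snd‖ ≤ 2 * η * ‖y.snd‖ := by
    have : ‖u.snd‖ ≤ 2 * ‖y.snd‖ := by nlinarith [norm_nonneg u.snd]
    nlinarith
  rw [dist_comm, dist_eq_norm]
  have hsq : ‖u - WithLp.toLp 2 ((0 : X), y.snd)‖ ^ 2 = ‖u.fst‖ ^ 2 + ‖u.snd - y.snd‖ ^ 2 := by
    rw [WithLp.prod_norm_sq_eq_of_L2]
    simp
  have : ‖u - WithLp.toLp 2 ((0 : X), y.snd)‖ ≤ ‖u.fst‖ + ‖u.snd - y.snd‖ := by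
    refine abs_le_of_sq_le_sq' ?_ (by positivity) |>.2
    rw [hsq]
    nlinarith [norm_nonneg u.fst, norm_nonneg (u.snd - y.snd)]
  nlinarith

lemma dsum_rat (T : X →L[ℂ] X) (U : Y →L[ℂ] Y) (hU : ‖U‖ ≤ 1) (a : ℂ) {ρ s : ℝ} (hρ : 0 < ρ)
    (hρs : ρ < s) (x : Fin m → X) (w : Fin m → Y) (L L' : Set ℂ) (hLL' : L' ⊆ L)
    (hL : Metric.closedBall a ρ ⊆ L)
    (hL' : ∀ z ∈ L', s < ‖z - a‖) (hT : ∀ z ∈ spectrum ℂ T, s < ‖z - a‖)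
    (hD : Dense (ratD T x L))
    (hw : Dense (cycAll (a • (1 : Y →L[ℂ] Y) + (ρ : ℂ) • U) w : Set Y)) :
    Dense (ratD (dsum T (a • (1 : Y →L[ℂ] Y) + (ρ : ℂ) • U))
      (fun k => WithLp.toLp 2 (x k, w k)) L') := by
  have hsep := fun y hy => sep_snd T U hU a hρ hρs (fun k => WithLp.toLp 2 (x k, w k)) L' hL' hT
    (y := y) hy
  have hSspec := spectrum_disc U hU a hρ
  set S := a • (1 : Y →L[ℂ] Y) + (ρ : ℂ) • U with hS
  set z₀ : Fin m → WithLp 2 (X × Y) := fun k => WithLp.toLp 2 (x k, w k) with hz₀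
  set M := (ratSub (dsum T S) z₀ L').topologicalClosure with hM
  have hMc : IsClosed (M : Set (WithLp 2 (X × Y))) := Submodule.isClosed_topologicalClosure _
  have hDM : ∀ y ∈ ratD (dsum T S) z₀ L', y ∈ M := fun y hy =>
    (ratSub (dsum T S) z₀ L').le_topologicalClosure hy
  have hfst : ∀ y ∈ ratD (dsum T S) z₀ L', WithLp.toLp 2 (y.fst, (0 : Y)) ∈ M := fun y hy => by
    have h := M.sub_mem (hDM y hy) (hsep y hy)
    have he : y - WithLp.toLp 2 ((0 : X), y.snd) = WithLp.toLp 2 (y.fst, (0 : Y)) := by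
      apply WithLp.ofLp_injective 2
      apply Prod.ext
      · change y.fst - 0 = y.fst
        simp
      · change y.snd - y.snd = 0
        simp
    rwa [he] at h
  have h1 : ∀ v : X, WithLp.toLp 2 (v, (0 : Y)) ∈ M := by
    intro v
    have hc : Continuous fun v : X => WithLp.toLp 2 (v, (0 : Y)) :=
      (WithLp.prod_continuous_toLp 2 X Y).comp (by fun_prop)
    have hcl := hMc.preimage hc
    refine hcl.closure_subset_iff.mpr ?_ (hD v)
    rintro v ⟨q, hq1, hq2, hq3⟩
    obtain ⟨Z, hZ, hZ1⟩ := lift_fst T S x w hq3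
    have hqS : IsUnit (Polynomial.aeval S q) :=
      isUnit_aeval_of S q fun z hz => hq1 z (hL (hSspec hz))
    obtain ⟨u, huD, hu⟩ := ratD_div (dsum T S) z₀ L' (cycAll_le_ratSub _ _ L' hZ) q
      (fun z hz => hq1 z (hLL' hz)) (by rw [dsum_aeval]; exact dsum_isUnit hq2 hqS)
    have huv : u.fst = v := by
      rw [dsum_aeval] at hu
      have h3 : Polynomial.aeval T q u.fst = Polynomial.aeval T q v := by
        rw [← hZ1, ← hu]; rfl
      exact (isUnit_iff_bijective.mp hq2).1 h3
    have := hfst u huD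
    rwa [huv] at this
  have h2 : ∀ v : Y, WithLp.toLp 2 ((0 : X), v) ∈ M := by
    intro v
    have hc : Continuous fun v : Y => WithLp.toLp 2 ((0 : X), v) :=
      (WithLp.prod_continuous_toLp 2 X Y).comp (by fun_prop)
    have hcl := hMc.preimage hc
    refine hcl.closure_subset_iff.mpr ?_ (hw v)
    intro v hv
    obtain ⟨Z, hZ, hZ1⟩ := lift_snd T S x w hv
    have := hsep Z (cycAll_le_ratSub _ _ L' hZ)
    rwa [hZ1] at this
  intro z
  change z ∈ M
  have he : z = WithLp.toLp 2 (z.fst, (0 : Y)) + WithLp.toLp 2 ((0 : X), z.snd) := by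
    apply WithLp.ofLp_injective 2
    apply Prod.ext
    · change z.fst = z.fst + 0
      simp
    · change z.snd = 0 + z.snd
      simp
  rw [he]
  exact M.add_mem (h1 _) (h2 _)

end

lemma disc_bound (m : ℕ) (r : ℂ → ℝ) (R : ℝ) (t : Finset ℂ) :
    (∀ a ∈ t, 0 < r a) → (∀ a ∈ t, ‖a‖ + r a ≤ R) →
    ((t : Set ℂ).PairwiseDisjoint fun a => Metric.closedBall a (r a)) →
    ∀ (X : Type u) [NormedAddCommGroup X] [InnerProductSpace ℂ X] [CompleteSpace X]
      (T : X →L[ℂ] X) (x : Fin m → X), Hyponormal T → ‖T‖ ≤ R →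
      (∀ a ∈ t, Disjoint (Metric.closedBall a (r a)) (spectrum ℂ T)) →
      Dense (ratD T x (⋃ a ∈ t, Metric.closedBall a (r a))) →
      ∀ (κ : Type) [Fintype κ] (f : κ → X), Orthonormal ℂ f →
        ∑ i, (‖T (f i)‖ ^ 2 - ‖adjoint T (f i)‖ ^ 2) + m * ∑ a ∈ t, r a ^ 2 ≤ m * R ^ 2 := by
  classical
  induction t using Finset.induction_on with
  | empty =>
    intro _ _ _ X _ _ _ T x hT hTR _ hD κ _ f hf
    have h := trace_le_of_rat T hT x _ hD hf
    have h2 : (m : ℝ) * ‖T‖ ^ 2 ≤ m * R ^ 2 := by gcongr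
    simp only [Finset.sum_empty, mul_zero, add_zero]
    exact h.trans h2
  | insert a t hat ih =>
    intro hr hR hdisj X _ _ _ T x hT hTR hσ hD κ _ f hf
    have hra : 0 < r a := hr a (Finset.mem_insert_self a t)
    set L' : Set ℂ := ⋃ b ∈ t, Metric.closedBall b (r b) with hL'
    have hL'c : IsClosed L' :=
      Set.Finite.isClosed_biUnion t.finite_toSet fun b _ => Metric.isClosed_closedBall
    have hd : Disjoint (Metric.closedBall a (r a)) (L' ∪ spectrum ℂ T) := by
      rw [Set.disjoint_union_right]
      refine ⟨?_, hσ a (Finset.mem_insert_self a t)⟩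
      rw [hL', Set.disjoint_iUnion₂_right]
      intro b hb
      exact hdisj (Finset.mem_insert_self a t) (Finset.mem_insert_of_mem hb)
        (fun h => hat (h ▸ hb))
    obtain ⟨δ, hδ, hδd⟩ := hd.exists_cthickenings (isCompact_closedBall a (r a))
      (hL'c.union (spectrum.isClosed T))
    rw [cthickening_closedBall hδ.le hra.le] at hδd
    have hfar : ∀ z ∈ L' ∪ spectrum ℂ T, δ + r a < ‖z - a‖ := by
      intro z hz
      by_contra hcon
      have hz1 : z ∈ Metric.closedBall a (δ + r a) := by
        rw [mem_closedBall_iff_norm]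
        exact not_lt.mp hcon
      exact Set.disjoint_left.mp hδd hz1 (Metric.self_subset_cthickening _ hz)
    obtain ⟨U, w, hU, hw, hSh, hSw, hSd⟩ := exists_disc_op m a hra
    have hSspec := spectrum_disc U hU a hra
    have hrat := dsum_rat T U hU a hra (show r a < δ + r a by linarith) x w
      (⋃ b ∈ insert a t, Metric.closedBall b (r b)) L'
      (Set.biUnion_subset_biUnion_left fun b hb => Finset.mem_insert_of_mem hb)
      (Set.subset_biUnion_of_mem (u := fun b => Metric.closedBall b (r b))
        (Finset.mem_insert_self a t))
      (fun z hz => hfar z (Or.inl hz)) (fun z hz => hfar z (Or.inr hz)) hD hSd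
    have hSn : ‖a • (1 : ShiftSpace m →L[ℂ] ShiftSpace m) + ((r a : ℝ) : ℂ) • U‖ ≤ R := by
      refine le_trans ?_ (hR a (Finset.mem_insert_self a t))
      refine (norm_add_le _ _).trans ?_
      rw [norm_smul, norm_smul, Complex.norm_real, Real.norm_of_nonneg hra.le]
      have h3 : ‖(1 : ShiftSpace m →L[ℂ] ShiftSpace m)‖ ≤ 1 := norm_id_le
      have := norm_nonneg a
      nlinarith
    set S := a • (1 : ShiftSpace m →L[ℂ] ShiftSpace m) + ((r a : ℝ) : ℂ) • U with hS
    have hforth : Orthonormal ℂ (Sum.elim (fun i => WithLp.toLp 2 (f i, (0 : ShiftSpace m)))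
        (fun k => WithLp.toLp 2 ((0 : X), w k)) : κ ⊕ Fin m → WithLp 2 (X × ShiftSpace m)) := by
      rw [orthonormal_iff_ite] at hf hw ⊢
      rintro (i | i) (j | j)
      · simp [WithLp.prod_inner_apply, hf]
      · simp [WithLp.prod_inner_apply]
      · simp [WithLp.prod_inner_apply]
      · simp [WithLp.prod_inner_apply, hw]
    have key := ih (fun b hb => hr b (Finset.mem_insert_of_mem hb))
      (fun b hb => hR b (Finset.mem_insert_of_mem hb))
      (hdisj.subset fun b hb => Finset.mem_insert_of_mem hb)
      (WithLp 2 (X × ShiftSpace m)) (dsum T S) _ (dsum_hyponormal hT hSh)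
      (dsum_norm_le T S hTR hSn)
      (fun b hb => by
        refine Set.disjoint_of_subset_right ((dsum_spectrum T S).trans
          (Set.union_subset_union_right _ hSspec)) ?_
        rw [Set.disjoint_union_right]
        refine ⟨hσ b (Finset.mem_insert_of_mem hb), ?_⟩
        exact hdisj (Finset.mem_insert_of_mem hb) (Finset.mem_insert_self a t)
          (fun h => hat (h ▸ hb)))
      hrat (κ ⊕ Fin m) _ hforth
    rw [Fintype.sum_sum_type] at key
    simp only [Sum.elim_inl, Sum.elim_inr, dsum_adjoint, dsum_norm_sq, WithLp.toLp_fst,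
      WithLp.toLp_snd, map_zero, norm_zero, ne_eq, OfNat.ofNat_ne_zero, not_false_eq_true,
      zero_pow, add_zero, zero_add, hSw, Finset.sum_const, Finset.card_univ, Fintype.card_fin,
      nsmul_eq_mul] at key
    rw [Finset.sum_insert hat]
    linarith

/-- **Berger-Shaw**, for finite orthonormal families. -/
lemma berger_shaw {X : Type u} [NormedAddCommGroup X] [InnerProductSpace ℂ X] [CompleteSpace X]
    (T : X →L[ℂ] X) (hT : Hyponormal T) {m : ℕ} (hc : IsPolyCyclicOp T m)
    {n : ℕ} {f : Fin n → X} (hf : Orthonormal ℂ f) :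
    ∑ i, (‖T (f i)‖ ^ 2 - ‖adjoint T (f i)‖ ^ 2)
      ≤ m / Real.pi * (volume (spectrum ℂ T)).toReal := by
  obtain ⟨⟨ξ, hξ, hd⟩, -⟩ := hc
  set x : Fin m → X := fun k => ((ξ.equivFinOfCardEq hξ).symm k : X) with hx
  have hcyc : Dense (cycAll T x : Set X) := by
    refine hd.mono ?_
    refine Submodule.span_mono ?_
    rintro _ ⟨v, hv, k, rfl⟩
    refine ⟨(ξ.equivFinOfCardEq hξ ⟨v, hv⟩, k), ?_⟩
    simp [hx]
  have hrat : ∀ L, Dense (ratD T x L) := fun L =>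
    hcyc.mono fun y hy => cycAll_le_ratSub T x L hy
  set R : ℝ := ‖T‖ + 1 with hR
  have hRpos : 0 < R := by positivity
  have hσR : spectrum ℂ T ⊆ Metric.ball 0 R := by
    refine (spectrum.subset_closedBall_norm_mul T).trans (Metric.closedBall_subset_ball ?_)
    have h3 : ‖(1 : X →L[ℂ] X)‖ ≤ 1 := norm_id_le
    have := norm_nonneg T
    nlinarith
  have hσfin : volume (spectrum ℂ T) ≠ ⊤ :=
    ((measure_mono hσR).trans_lt measure_ball_lt_top).ne
  set s : Set ℂ := Metric.ball 0 R \ spectrum ℂ T with hs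
  have hso : IsOpen s := Metric.isOpen_ball.sdiff (spectrum.isClosed T)
  obtain ⟨t, r, htc, hts, htr, hcov, hdisj⟩ :=
    Besicovitch.exists_disjoint_closedBall_covering_ae (volume : Measure ℂ)
      (fun a => {q : ℝ | Metric.closedBall a q ⊆ s ∧ ‖a‖ + q ≤ R}) s
      (by
        intro a ha δ hδ
        obtain ⟨ε, hε, hεs⟩ := Metric.nhds_basis_closedBall.mem_iff.mp (hso.mem_nhds ha)
        have haR : ‖a‖ < R := by simpa using ha.1
        refine ⟨min ε (min (δ / 2) (R - ‖a‖)), ⟨?_, ?_⟩, ?_, ?_⟩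
        · exact (Metric.closedBall_subset_closedBall (min_le_left _ _)).trans hεs
        · have h1 := min_le_right ε (min (δ / 2) (R - ‖a‖))
          have h2 := min_le_right (δ / 2) (R - ‖a‖)
          linarith
        · have : 0 < R - ‖a‖ := by linarith
          positivity
        · have h1 := min_le_right ε (min (δ / 2) (R - ‖a‖))
          have h2 := min_le_left (δ / 2) (R - ‖a‖)
          linarith)
      (fun _ => 1) (fun _ _ => one_pos)
  set v := ∑ i, (‖T (f i)‖ ^ 2 - ‖adjoint T (f i)‖ ^ 2) with hv
  have hfinite : ∀ F : Finset ℂ, (F : Set ℂ) ⊆ t → v + m * ∑ a ∈ F, r a ^ 2 ≤ m * R ^ 2 := by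
    intro F hF
    refine disc_bound m r R F (fun a ha => (htr a (hF ha)).2.1) (fun a ha => (htr a (hF ha)).1.2)
      (hdisj.subset hF) X T x hT (by rw [hR]; linarith) (fun a ha => ?_) (hrat _) (Fin n) f hf
    refine Set.disjoint_left.mpr fun z hz => ?_
    exact ((htr a (hF ha)).1.1 hz).2
  have hnn : 0 ≤ m * R ^ 2 - v := by
    have := hfinite ∅ (by simp)
    simp only [Finset.sum_empty, mul_zero, add_zero] at this
    linarith
  have hvs : volume s ≤ ∑' a : t, volume (Metric.closedBall (a : ℂ) (r a)) := by
    have h1 : volume s ≤ volume (⋃ a ∈ t, Metric.closedBall a (r a))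
        + volume (s \ ⋃ a ∈ t, Metric.closedBall a (r a)) := by
      refine (measure_mono ?_).trans (measure_union_le _ _)
      intro z hz
      by_cases h : z ∈ ⋃ a ∈ t, Metric.closedBall a (r a)
      · exact Or.inl h
      · exact Or.inr ⟨hz, h⟩
    rw [hcov, add_zero] at h1
    exact h1.trans (measure_biUnion_le _ htc _)
  have hms : (m : ℝ≥0∞) * volume s ≤ ENNReal.ofReal (Real.pi * (m * R ^ 2 - v)) := by
    refine (mul_le_mul_right hvs _).trans ?_
    rw [← ENNReal.tsum_mul_left, ENNReal.tsum_eq_iSup_sum]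
    refine iSup_le fun F => ?_
    have h1 : ∀ a : t, (m : ℝ≥0∞) * volume (Metric.closedBall (a : ℂ) (r a))
        = ENNReal.ofReal (m * (r a ^ 2 * Real.pi)) := by
      intro a
      have hra := (htr a a.2).2.1
      rw [Complex.volume_closedBall, ENNReal.ofReal_mul (by positivity),
        ENNReal.ofReal_mul (by positivity), ENNReal.ofReal_pow hra.le, ENNReal.ofReal_natCast]
      congr 2
      rw [← NNReal.coe_real_pi, ENNReal.ofReal_coe_nnreal]
    simp only [h1]
    rw [← ENNReal.ofReal_sum_of_nonneg (fun a _ => by positivity)]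
    apply ENNReal.ofReal_le_ofReal
    have h2 := hfinite (F.map (Function.Embedding.subtype _)) (by
      intro a ha
      simp only [Finset.coe_map, Set.mem_image] at ha
      obtain ⟨b, -, rfl⟩ := ha
      exact b.2)
    rw [Finset.sum_map] at h2
    simp only [Function.Embedding.subtype_apply] at h2
    rw [← Finset.mul_sum, ← Finset.sum_mul]
    nlinarith [Real.pi_pos]
  have hball : volume (Metric.ball (0 : ℂ) R) = volume s + volume (spectrum ℂ T) := by
    rw [hs, measure_diff hσR (spectrum.isClosed T).nullMeasurableSet hσfin,
      tsub_add_cancel_of_le (measure_mono hσR)]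
  have hsfin : volume s ≠ ⊤ :=
    ((measure_mono Set.diff_subset).trans_lt (measure_ball_lt_top (x := (0 : ℂ)) (r := R))).ne
  have hms' : m * (volume s).toReal ≤ Real.pi * (m * R ^ 2 - v) := by
    have := ENNReal.toReal_mono ENNReal.ofReal_ne_top hms
    rwa [ENNReal.toReal_mul, ENNReal.toReal_natCast,
      ENNReal.toReal_ofReal (mul_nonneg Real.pi_pos.le hnn)] at this
  have hball' : R ^ 2 * Real.pi = (volume s).toReal + (volume (spectrum ℂ T)).toReal := by
    have := congrArg ENNReal.toReal hball
    rw [ENNReal.toReal_add hsfin hσfin, Complex.volume_ball, ENNReal.toReal_mul,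
      ENNReal.toReal_pow, ENNReal.toReal_ofReal hRpos.le] at this
    exact this
  rw [div_mul_eq_mul_div, le_div_iff₀ Real.pi_pos]
  have : (volume s).toReal = R ^ 2 * Real.pi - (volume (spectrum ℂ T)).toReal := by linarith
  rw [this] at hms'
  nlinarith

lemma traceNorm_le_of {X : Type u} [NormedAddCommGroup X] [InnerProductSpace ℂ X]
    [CompleteSpace X] (C : X →L[ℂ] X) (c : ℝ)
    (h : ∀ (n : ℕ) (f g : Fin n → X), Orthonormal ℂ f → Orthonormal ℂ g →
      ∑ i, ‖inner ℂ (C (f i)) (g i)‖ ≤ c) : traceNorm C ≤ ENNReal.ofReal c := by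
  unfold traceNorm
  refine iSup_le fun n => iSup_le fun f => iSup_le fun g => iSup_le fun hf => iSup_le fun hg => ?_
  refine le_trans (le_of_eq ?_) (ENNReal.ofReal_le_ofReal (h n f g hf hg))
  rw [ENNReal.ofReal_sum_of_nonneg (fun _ _ => norm_nonneg _)]
  refine Finset.sum_congr rfl fun i _ => ?_
  rw [ofReal_norm_eq_enorm]
  rfl

lemma traceNorm_self {X : Type u} [NormedAddCommGroup X] [InnerProductSpace ℂ X]
    [CompleteSpace X] (T : X →L[ℂ] X) (hT : Hyponormal T) (c : ℝ)
    (h : ∀ (n : ℕ) (f : Fin n → X), Orthonormal ℂ f →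
      ∑ i, (‖T (f i)‖ ^ 2 - ‖adjoint T (f i)‖ ^ 2) ≤ c) :
    traceNorm (cmt (adjoint T) T) ≤ ENNReal.ofReal c := by
  obtain ⟨S, hS⟩ := exists_sqrt _ hT
  have hS' : ∀ z, ‖S z‖ ^ 2 = ‖T z‖ ^ 2 - ‖adjoint T z‖ ^ 2 := fun z => by
    have h := hS z z
    rw [re_inner_selfcomm, inner_self_eq_norm_sq_to_K] at h
    rw [← RCLike.ofReal_pow] at h
    exact (Complex.ofReal_injective h).symm
  refine traceNorm_le_of _ c fun n f g hf hg => ?_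
  have h1 := h n f hf
  have h2 := h n g hg
  simp only [← hS'] at h1 h2
  have h3 : ∑ i, ‖inner ℂ (cmt (adjoint T) T (f i)) (g i)‖
      ≤ ∑ i, (‖S (f i)‖ ^ 2 + ‖S (g i)‖ ^ 2) / 2 := by
    refine Finset.sum_le_sum fun i _ => ?_
    rw [hS]
    refine (norm_inner_le_norm _ _).trans ?_
    nlinarith [sq_nonneg (‖S (f i)‖ - ‖S (g i)‖)]
  rw [← Finset.sum_div, Finset.sum_add_distrib] at h3
  linarith

/-- The self-commutator quadratic form. -/
def qf {X : Type u} [NormedAddCommGroup X] [InnerProductSpace ℂ X]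
    [CompleteSpace X] (T : X →L[ℂ] X) (x : X) : ℝ := ‖T x‖ ^ 2 - ‖adjoint T x‖ ^ 2

lemma qf_par {X : Type u} [NormedAddCommGroup X] [InnerProductSpace ℂ X]
    [CompleteSpace X] (T : X →L[ℂ] X) (x y : X) :
    qf T (x + y) + qf T (x - y) = 2 * (qf T x + qf T y) := by
  have h1 := parallelogram_law_with_norm ℂ (T x) (T y)
  have h2 := parallelogram_law_with_norm ℂ (adjoint T x) (adjoint T y)
  simp only [qf, map_add, map_sub]
  linarith

lemma qf_I {X : Type u} [NormedAddCommGroup X] [InnerProductSpace ℂ X]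
    [CompleteSpace X] (T : X →L[ℂ] X) (x : X) : qf T (Complex.I • x) = qf T x := by
  simp [qf, norm_smul]

lemma cross_bound {X : Type u} [NormedAddCommGroup X] [InnerProductSpace ℂ X]
    [CompleteSpace X] (A B : X →L[ℂ] X) (h : ∀ β : ℂ, Hyponormal (A + β • B)) (x : X) :
    ‖inner ℂ (cmt (adjoint B) A x) x‖ ≤ (qf A x + qf B x) / 2 := by
  set c := inner ℂ (cmt (adjoint B) A x) x with hc
  obtain ⟨β, hβ1, hβ2⟩ : ∃ β : ℂ, ‖β‖ = 1 ∧ β * c = -(‖c‖ : ℂ) := by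
    by_cases h0 : c = 0
    · exact ⟨1, by simp, by simp [h0]⟩
    · have hn : (‖c‖ : ℂ) ≠ 0 := by simpa using h0
      refine ⟨-(starRingEnd ℂ c / ‖c‖), ?_, ?_⟩
      · rw [norm_neg, norm_div, RCLike.norm_conj, Complex.norm_real, norm_norm, div_self]
        simpa using h0
      · rw [neg_mul, div_mul_eq_mul_div, Complex.conj_mul']
        field_simp
  have hh := (hyponormal_iff_norm _).mp (h β) x
  have hadj : adjoint (A + β • B) x = adjoint A x + (starRingEnd ℂ β) • adjoint B x := by
    refine ext_inner_right ℂ fun v => ?_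
    rw [adjoint_inner_left]
    simp only [add_apply, smul_apply, inner_add_left, inner_add_right, inner_smul_left,
      inner_smul_right, adjoint_inner_left, Complex.conj_conj]
  have happ : (A + β • B) x = A x + β • B x := rfl
  rw [hadj, happ, norm_add_sq (𝕜 := ℂ), norm_add_sq (𝕜 := ℂ), norm_smul, norm_smul,
    RCLike.norm_conj, hβ1] at hh
  have hcc : c = inner ℂ (A x) (B x) - inner ℂ (adjoint B x) (adjoint A x) := by
    have he : cmt (adjoint B) A x = adjoint B (A x) - A (adjoint B x) := rfl
    rw [hc, he, inner_sub_left, adjoint_inner_left, adjoint_inner_right]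
  have h2 : RCLike.re (inner ℂ (adjoint A x) ((starRingEnd ℂ β) • adjoint B x))
      = RCLike.re (β * inner ℂ (adjoint B x) (adjoint A x)) := by
    rw [← inner_conj_symm, RCLike.conj_re, inner_smul_left, Complex.conj_conj]
  have h3 : RCLike.re (inner ℂ (A x) (β • B x)) - RCLike.re (β * inner ℂ (adjoint B x) (adjoint A x))
      = -‖c‖ := by
    rw [inner_smul_right, ← map_sub, ← mul_sub, ← hcc, hβ2]
    simp
  rw [h2] at hh
  simp only [qf]
  linarith

lemma cross_polar {X : Type u} [NormedAddCommGroup X] [InnerProductSpace ℂ X]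
    [CompleteSpace X] (A B : X →L[ℂ] X) (h : ∀ β : ℂ, Hyponormal (A + β • B)) (x y : X) :
    ‖inner ℂ (cmt (adjoint B) A y) x‖ ≤ ((qf A x + qf B x) + (qf A y + qf B y)) / 2 := by
  have hp := inner_map_polarization ((cmt (adjoint B) A : X →L[ℂ] X) : X →ₗ[ℂ] X) x y
  simp only [ContinuousLinearMap.coe_coe] at hp
  rw [hp, norm_div]
  have b1 := cross_bound A B h (x + y)
  have b2 := cross_bound A B h (x - y)
  have b3 := cross_bound A B h (x + Complex.I • y)
  have b4 := cross_bound A B h (x - Complex.I • y)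
  have pA := qf_par A x y
  have pB := qf_par B x y
  have pA' := qf_par A x (Complex.I • y)
  have pB' := qf_par B x (Complex.I • y)
  rw [qf_I] at pA' pB'
  set w1 := inner ℂ (cmt (adjoint B) A (x + y)) (x + y)
  set w2 := inner ℂ (cmt (adjoint B) A (x - y)) (x - y)
  set w3 := inner ℂ (cmt (adjoint B) A (x + Complex.I • y)) (x + Complex.I • y)
  set w4 := inner ℂ (cmt (adjoint B) A (x - Complex.I • y)) (x - Complex.I • y)
  have hn : ‖w1 - w2 + Complex.I * w3 - Complex.I * w4‖ ≤ ‖w1‖ + ‖w2‖ + ‖w3‖ + ‖w4‖ := by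
    have e1 := norm_sub_le (w1 - w2 + Complex.I * w3) (Complex.I * w4)
    have e2 := norm_add_le (w1 - w2) (Complex.I * w3)
    have e3 := norm_sub_le w1 w2
    rw [norm_mul, Complex.norm_I, one_mul] at e1 e2
    linarith
  have h4 : ‖(4 : ℂ)‖ = 4 := by simp
  rw [h4, div_le_iff₀ (by norm_num)]
  linarith

lemma traceNorm_cross {X : Type u} [NormedAddCommGroup X] [InnerProductSpace ℂ X]
    [CompleteSpace X] (A B : X →L[ℂ] X) (h : ∀ β : ℂ, Hyponormal (A + β • B)) (a b : ℝ)
    (hA : ∀ (n : ℕ) (f : Fin n → X), Orthonormal ℂ f →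
      ∑ i, (‖A (f i)‖ ^ 2 - ‖adjoint A (f i)‖ ^ 2) ≤ a)
    (hB : ∀ (n : ℕ) (f : Fin n → X), Orthonormal ℂ f →
      ∑ i, (‖B (f i)‖ ^ 2 - ‖adjoint B (f i)‖ ^ 2) ≤ b) :
    traceNorm (cmt (adjoint B) A) ≤ ENNReal.ofReal (a + b) := by
  refine traceNorm_le_of _ _ fun n f g hf hg => ?_
  have h1 := hA n f hf
  have h2 := hA n g hg
  have h3 := hB n f hf
  have h4 := hB n g hg
  have h5 : ∑ i, ‖inner ℂ (cmt (adjoint B) A (f i)) (g i)‖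
      ≤ ∑ i, ((qf A (g i) + qf B (g i)) + (qf A (f i) + qf B (f i))) / 2 :=
    Finset.sum_le_sum fun i _ => cross_polar A B h (g i) (f i)
  rw [← Finset.sum_div, Finset.sum_add_distrib, Finset.sum_add_distrib,
    Finset.sum_add_distrib] at h5
  simp only [qf] at h5
  linarith

end BergerShaw

/-- Berger-Shaw type trace bounds for a projectively hyponormal commuting tuple
whose members are individually polynomially cyclic. -/
theorem statement_6 {d : ℕ} [TopologicalSpace.SeparableSpace H]
    (T : Fin d → H →L[ℂ] H) (hcomm : ∀ i j, Commute (T i) (T j))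
    (hph : ProjHyponormal T) (m : Fin d → ℕ) (hcyc : ∀ i, IsPolyCyclicOp (T i) (m i)) :
    (∀ i j, IsTraceClass (cmt (adjoint (T j)) (T i))) ∧
    (∀ i, traceNorm (cmt (adjoint (T i)) (T i)) ≤
        (m i : ℝ≥0∞) / ENNReal.ofReal Real.pi * volume (spectrum ℂ (T i))) ∧
    (∀ i j, i ≠ j → traceNorm (cmt (adjoint (T j)) (T i)) ≤
        (m i : ℝ≥0∞) / ENNReal.ofReal Real.pi * volume (spectrum ℂ (T i)) +
          (m j : ℝ≥0∞) / ENNReal.ofReal Real.pi * volume (spectrum ℂ (T j))) := by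
  have hone : ∀ i, Hyponormal (T i) := by
    intro i
    have h := hph (Pi.single i 1)
    simpa [Pi.single_apply, ite_smul] using h
  have htwo : ∀ i j (β : ℂ), Hyponormal (T i + β • T j) := by
    intro i j β
    have h := hph (Pi.single i 1 + Pi.single j β)
    simpa [Pi.single_apply, ite_smul, add_smul, Finset.sum_add_distrib] using h
  have hfin : ∀ i, volume (spectrum ℂ (T i)) ≠ ⊤ := fun i =>
    (spectrum.isCompact (T i)).measure_lt_top.ne
  have hc : ∀ i, (m i : ℝ≥0∞) / ENNReal.ofReal Real.pi * volume (spectrum ℂ (T i))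
      = ENNReal.ofReal (m i / Real.pi * (volume (spectrum ℂ (T i))).toReal) := by
    intro i
    rw [ENNReal.ofReal_mul (by positivity), ENNReal.ofReal_div_of_pos Real.pi_pos,
      ENNReal.ofReal_toReal (hfin i), ENNReal.ofReal_natCast]
  have hbs : ∀ i (n : ℕ) (f : Fin n → H), Orthonormal ℂ f →
      ∑ k, (‖T i (f k)‖ ^ 2 - ‖adjoint (T i) (f k)‖ ^ 2)
        ≤ m i / Real.pi * (volume (spectrum ℂ (T i))).toReal :=
    fun i n f hf => berger_shaw (T i) (hone i) (hcyc i) hf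
  have hself := fun i => traceNorm_self (T i) (hone i) _ (hbs i)
  have hcross := fun i j => traceNorm_cross (T i) (T j) (htwo i j) _ _ (hbs i) (hbs j)
  refine ⟨fun i j => ?_, fun i => ?_, fun i j _ => ?_⟩
  · exact ((hcross i j).trans_lt ENNReal.ofReal_lt_top).ne
  · rw [hc]
    exact hself i
  · rw [hc, hc, ← ENNReal.ofReal_add (by positivity) (by positivity)]
    exact hcross i j
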